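/- Let A, B ∈ ℤ with 4A³ + 27B² ≠ 0. Then there exists δ > 0 such that the set Q of prime numbers ℓ satisfying ℓ ≡ 3 or 5 (mod 8) and such that the cubic x³ + Ax + B has a root modulo ℓ has lower natural density at least δ; that is, liminf_{X→∞} Q(X)/π(X) ≥ δ > 0. -/

import Mathlib

open Filter

/-- The number of primes `ℓ ∈ S` with `ℓ ≤ X`. -/
noncomputable def primeCount (S : Set ℕ) (X : ℝ) : ℕ :=
  Nat.card {p : ℕ | p.Prime ∧ p ∈ S ∧ (p : ℝ) ≤ X}

/-- The prime counting function `π(X)`. -/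
noncomputable def primePi (X : ℝ) : ℕ :=
  Nat.card {p : ℕ | p.Prime ∧ (p : ℝ) ≤ X}

section Part1
open Filter

section Cover
variable {R : Type*} [CommRing R] [IsDedekindDomain R] [Module.Free ℤ R]
  {ι : Type*} [Fintype ι] [DecidableEq ι]

/-- Every nonzero ideal contains a nonzero element with small coordinates. -/
theorem aux_small (b : Module.Basis ι ℤ R) (I : Ideal R) (hI : I ≠ ⊥) (m : ℕ)
    (hm : Ideal.absNorm I < (m + 1) ^ Fintype.card ι) :
    ∃ g ∈ I, g ≠ 0 ∧ ∀ i, |b.repr g i| ≤ m := by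
  classical
  have : Module.Finite ℤ R := Module.Finite.of_basis b
  have hfin : Finite (R ⧸ I) := Ideal.finiteQuotientOfFreeOfNeBot I hI
  have := Fintype.ofFinite (R ⧸ I)
  have hcard : Fintype.card (R ⧸ I) = Ideal.absNorm I := by
    rw [Ideal.absNorm_apply, Submodule.cardQuot_apply, Nat.card_eq_fintype_card]
  let φ : (ι → Fin (m+1)) → R ⧸ I := fun a => Ideal.Quotient.mk I (∑ i, ((a i : ℕ) : ℤ) • b i)
  have hlt : Fintype.card (R ⧸ I) < Fintype.card (ι → Fin (m+1)) := by
    rw [hcard]; simpa using hm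
  obtain ⟨x, y, hxy, h⟩ := Fintype.exists_ne_map_eq_of_card_lt φ hlt
  have hr : ∀ i, b.repr (∑ i, ((x i : ℕ) : ℤ) • b i - ∑ i, ((y i : ℕ) : ℤ) • b i) i
      = (x i : ℕ) - (y i : ℕ) := by
    intro i
    rw [map_sub, Finsupp.sub_apply, b.repr_sum_self, b.repr_sum_self]
  refine ⟨∑ i, ((x i : ℕ) : ℤ) • b i - ∑ i, ((y i : ℕ) : ℤ) • b i,
    Ideal.Quotient.eq.mp h, ?_, ?_⟩
  · intro h0
    apply hxy
    ext i
    have := hr i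
    rw [h0] at this
    simp at this
    omega
  · intro i
    rw [hr i, abs_le]
    have := (x i).2
    have := (y i).2
    constructor <;> omega

/-- Coordinates of products are bounded. -/
theorem aux_mul_coord (b : Module.Basis ι ℤ R) :
    ∃ C : ℕ, ∀ (x y : R) (m n : ℤ), (∀ i, |b.repr x i| ≤ m) → (∀ i, |b.repr y i| ≤ n) →
      ∀ i, |b.repr (x * y) i| ≤ C * m * n := by
  classical
  refine ⟨∑ k, ∑ l, ∑ j, (b.repr (b k * b l) j).natAbs, ?_⟩
  intro x y m n hx hy i
  have hxy : x * y = ∑ k, ∑ l, (b.repr x k * b.repr y l) • (b k * b l) := by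
    conv_lhs => rw [← b.sum_repr x, ← b.sum_repr y]
    rw [Finset.sum_mul_sum]
    refine Finset.sum_congr rfl fun k _ => Finset.sum_congr rfl fun l _ => ?_
    rw [smul_mul_smul_comm]
  rw [hxy]
  simp only [map_sum, map_smul, Finsupp.coe_finsetSum, Finset.sum_apply, Finsupp.smul_apply]
  push_cast
  rw [Finset.sum_mul, Finset.sum_mul]
  refine (Finset.abs_sum_le_sum_abs _ _).trans (Finset.sum_le_sum fun k _ => ?_)
  rw [Finset.sum_mul, Finset.sum_mul]
  refine (Finset.abs_sum_le_sum_abs _ _).trans (Finset.sum_le_sum fun l _ => ?_)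
  have h1 : |b.repr (b k * b l) i| ≤ ∑ j, |b.repr (b k * b l) j| :=
    Finset.single_le_sum (f := fun j => |b.repr (b k * b l) j|) (fun j _ => abs_nonneg _)
      (Finset.mem_univ i)
  have hm : 0 ≤ m := (abs_nonneg _).trans (hx k)
  rw [smul_eq_mul, abs_mul, abs_mul]
  calc |b.repr x k| * |b.repr y l| * |b.repr (b k * b l) i|
      ≤ m * n * ∑ j, |b.repr (b k * b l) j| := by
        have := hx k
        have h3 := hy l
        have hn : 0 ≤ n := (abs_nonneg _).trans h3
        gcongr
    _ = _ := by ring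

theorem aux_cover (b : Module.Basis ι ℤ R) :
    ∃ C : ℕ, 0 < C ∧ ∀ (I : Ideal R), I ≠ ⊥ → ∀ m : ℕ,
      Ideal.absNorm I < (m + 1) ^ Fintype.card ι →
      ∀ x : R, ∃ y, x - y ∈ I ∧ ∀ i, |b.repr y i| ≤ C * m := by
  classical
  obtain ⟨C, hC⟩ := aux_mul_coord b
  have : Module.Finite ℤ R := Module.Finite.of_basis b
  refine ⟨C + 1, Nat.succ_pos _, fun I hI m hm x => ?_⟩
  obtain ⟨g, hgI, hg0, hg⟩ := aux_small b I hI m hm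
  set N := Ideal.absNorm (Ideal.span {g}) with hN
  have hN0 : (0 : ℤ) < N := by
    have : N ≠ 0 := by
      rw [hN, Ne, Ideal.absNorm_eq_zero_iff]
      simpa using hg0
    omega
  obtain ⟨g', hg'⟩ := Ideal.mem_span_singleton.mp (Ideal.absNorm_mem (Ideal.span {g}))
  let z : R := ∑ i, (b.repr (g' * x) i / N) • b i
  let r : R := ∑ i, (b.repr (g' * x) i % N) • b i
  have hzr : g' * x = (N : ℤ) • z + r := by
    conv_lhs => rw [← b.sum_repr (g' * x)]
    simp only [z, r, Finset.smul_sum, smul_smul, ← Finset.sum_add_distrib, ← add_smul]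
    refine Finset.sum_congr rfl fun i _ => ?_
    rw [Int.mul_ediv_add_emod]
  have hkey : (N : ℤ) • (x - g * z) = g * r := by
    have h1 : g * (g' * x) = g * ((N : ℤ) • z + r) := by rw [hzr]
    rw [← mul_assoc, ← hg'] at h1
    rw [zsmul_eq_mul] at h1 ⊢
    push_cast at h1 ⊢
    linear_combination h1
  refine ⟨x - g * z, ?_, fun i => ?_⟩
  · rw [sub_sub_cancel]; exact I.mul_mem_right _ hgI
  · have hr : ∀ i, |b.repr r i| ≤ N := by
      intro i
      rw [b.repr_sum_self, abs_of_nonneg (Int.emod_nonneg _ hN0.ne')]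
      exact (Int.emod_lt_of_pos _ hN0).le
    have h2 := hC g r m N hg hr i
    rw [← hkey, map_smul, Finsupp.smul_apply, smul_eq_mul, abs_mul, abs_of_pos hN0] at h2
    have h3 : |b.repr (x - g * z) i| ≤ C * m := by
      have : (N : ℤ) * |b.repr (x - g * z) i| ≤ N * (C * m) := by linarith
      exact le_of_mul_le_mul_left this hN0
    push_cast
    nlinarith [Int.natCast_nonneg m]

/-- The coordinate box with corner `v` and side `T`. -/
noncomputable def cbox (v : ι → ℤ) (T : ℕ) : Finset (ι → ℤ) :=
  Fintype.piFinset fun i => Finset.Ico (v i) (v i + T)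

theorem card_cbox (v : ι → ℤ) (T : ℕ) : (cbox v T).card = T ^ Fintype.card ι := by
  simp [cbox]

theorem mem_cbox {v : ι → ℤ} {T : ℕ} {a : ι → ℤ} :
    a ∈ cbox v T ↔ ∀ i, v i ≤ a i ∧ a i < v i + T := by
  simp [cbox]

open Classical in
/-- Elements of the box lying in the ideal `I`. -/
noncomputable def cnt (b : Module.Basis ι ℤ R) (I : Ideal R) (v : ι → ℤ) (T : ℕ) : ℕ :=
  ((cbox v T).filter fun a => b.equivFun.symm a ∈ I).card

theorem aux_count (b : Module.Basis ι ℤ R) :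
    ∃ C : ℕ, 0 < C ∧ ∀ (I : Ideal R), I ≠ ⊥ → ∀ m : ℕ,
      Ideal.absNorm I < (m + 1) ^ Fintype.card ι → ∀ (v : ι → ℤ) (T : ℕ),
      Ideal.absNorm I * cnt b I v T ≤ (T + 2 * (C * m)) ^ Fintype.card ι ∧
      (T - 2 * (C * m)) ^ Fintype.card ι ≤ Ideal.absNorm I * cnt b I v T := by
  classical
  obtain ⟨C, hC0, hC⟩ := aux_cover b
  have : Module.Finite ℤ R := Module.Finite.of_basis b
  refine ⟨C, hC0, fun I hI m hm v T => ?_⟩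
  have hfin : Finite (R ⧸ I) := Ideal.finiteQuotientOfFreeOfNeBot I hI
  have := Fintype.ofFinite (R ⧸ I)
  have hcard : Fintype.card (R ⧸ I) = Ideal.absNorm I := by
    rw [Ideal.absNorm_apply, Submodule.cardQuot_apply, Nat.card_eq_fintype_card]
  set D := C * m with hD
  have hrep : ∀ c : R ⧸ I, ∃ y : R, Ideal.Quotient.mk I y = c ∧ ∀ i, |b.repr y i| ≤ D := by
    intro c
    obtain ⟨x, rfl⟩ := Ideal.Quotient.mk_surjective c
    obtain ⟨y, hy, hy'⟩ := hC I hI m hm x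
    exact ⟨y, (Ideal.Quotient.eq.mpr hy).symm, by simpa [hD] using hy'⟩
  choose r hr hr' using hrep
  have hr'' : ∀ c i, -(D:ℤ) ≤ b.repr (r c) i ∧ b.repr (r c) i ≤ D := fun c i => abs_le.mp (hr' c i)
  have hsum : ∀ a : ι → ℤ, b.repr (b.equivFun.symm a) = a := by
    intro a
    have := b.equivFun.apply_symm_apply a
    rwa [b.equivFun_apply] at this
  have hsum' : ∀ x : R, b.equivFun.symm (b.repr x) = x := by
    intro x
    have := b.equivFun.symm_apply_apply x
    rwa [b.equivFun_apply] at this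
  have hS : Ideal.absNorm I * cnt b I v T =
      ((Finset.univ : Finset (R ⧸ I)) ×ˢ
        ((cbox v T).filter fun a => b.equivFun.symm a ∈ I)).card := by
    rw [Finset.card_product, Finset.card_univ, hcard, cnt]
  rw [hS]
  constructor
  · rw [← card_cbox (fun i => v i - D) (T + 2 * D)]
    refine Finset.card_le_card_of_injOn (fun p => p.2 + ⇑(b.repr (r p.1))) ?_ ?_
    · rintro ⟨c, a⟩ h
      simp only [Finset.coe_product, Set.mem_prod, Finset.mem_coe, Finset.mem_filter,
        mem_cbox] at h ⊢
      intro i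
      have h1 := h.2.1 i
      have h2 := hr'' c i
      simp only [Pi.add_apply]
      push_cast
      constructor <;> omega
    · rintro ⟨c, a⟩ h ⟨c', a'⟩ h' heq
      simp only [Finset.coe_product, Set.mem_prod, Finset.mem_coe, Finset.mem_filter] at h h'
      have heq' : b.equivFun.symm a + r c = b.equivFun.symm a' + r c' := by
        apply b.repr.injective
        ext i
        have := congrFun heq i
        rw [map_add, map_add, Finsupp.add_apply, Finsupp.add_apply, hsum, hsum]
        exact this
      have hc : c = c' := by
        have := congrArg (Ideal.Quotient.mk I) heq'
        rwa [map_add, map_add, Ideal.Quotient.eq_zero_iff_mem.mpr h.2.2,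
          Ideal.Quotient.eq_zero_iff_mem.mpr h'.2.2, zero_add, zero_add, hr, hr] at this
      subst hc
      have : a = a' := by
        have := add_right_cancel heq'
        exact b.equivFun.symm.injective this
      rw [this]
  · rw [← card_cbox (fun i => v i + D) (T - 2 * D)]
    refine Finset.card_le_card_of_injOn (fun x =>
      (Ideal.Quotient.mk I (b.equivFun.symm x),
        x - ⇑(b.repr (r (Ideal.Quotient.mk I (b.equivFun.symm x)))))) ?_ ?_
    · intro x hx
      simp only [Finset.coe_product, Set.mem_prod, Finset.mem_coe, Finset.mem_filter,
        mem_cbox, Finset.mem_univ, true_and] at hx ⊢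
      refine ⟨fun i => ?_, ?_⟩
      · have h1 := hx i
        have h2 := hr'' (Ideal.Quotient.mk I (b.equivFun.symm x)) i
        simp only [Pi.sub_apply]
        constructor <;> omega
      · rw [map_sub, hsum']
        exact Ideal.Quotient.eq.mp (hr _).symm
    · intro x _ y _ h
      simp only [Prod.mk.injEq] at h
      rw [h.1] at h
      exact sub_left_injective h.2
end Cover
end Part1

section Part2
open Filter

theorem aux_pow_sub {a b : ℝ} (ha : 0 ≤ a) (hab : a ≤ b) (n : ℕ) :
    b ^ (n + 1) - a ^ (n + 1) ≤ (n + 1) * (b - a) * b ^ n := by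
  induction n with
  | zero => simp
  | succ n ih =>
    have hb : 0 ≤ b := ha.trans hab
    have h1 : a ^ (n + 1) ≤ b ^ (n + 1) := pow_le_pow_left₀ ha hab _
    have h2 := mul_le_mul_of_nonneg_left ih hb
    have h3 := mul_le_mul_of_nonneg_right h1 (sub_nonneg.mpr hab)
    push_cast
    calc b ^ (n + 1 + 1) - a ^ (n + 1 + 1) = b * (b ^ (n+1) - a ^ (n+1)) + a ^ (n+1) * (b - a) := by
          ring
      _ ≤ b * ((n + 1) * (b - a) * b ^ n) + b ^ (n+1) * (b - a) := by linarith
      _ = _ := by ring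

section Cnt
variable {R : Type*} [CommRing R] [IsDedekindDomain R] [Module.Free ℤ R]
  {ι : Type*} [Fintype ι] [DecidableEq ι]

theorem aux_count_real (b : Module.Basis ι ℤ R) (d : ℕ) (hd : Fintype.card ι = d + 1) (C₀ : ℝ)
    (hC₀ : 0 < C₀) :
    ∃ C : ℝ, 0 < C ∧ ∀ (I : Ideal R), I ≠ ⊥ → ∀ (v : ι → ℤ) (T : ℕ),
      (Ideal.absNorm I : ℝ) ≤ C₀ * T ^ (d + 1) →
      |(Ideal.absNorm I : ℝ) * cnt b I v T - T ^ (d + 1)| ≤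
        C * (Ideal.absNorm I : ℝ) ^ ((1 : ℝ) / (d + 1)) * T ^ d := by
  obtain ⟨A, hA0, hA⟩ := aux_count b
  set s : ℝ := (1 : ℝ) / (d + 1) with hs
  have hs0 : 0 < s := by positivity
  set κ : ℝ := 2 * A * C₀ ^ s with hκ
  have hκ0 : 0 ≤ κ := by positivity
  refine ⟨(d + 1) * (2 * A) * (1 + κ) ^ d, by positivity, fun I hI v T hT => ?_⟩
  set q : ℕ := Ideal.absNorm I with hq
  have hm : q < (⌊(q : ℝ) ^ s⌋₊ + 1) ^ Fintype.card ι := by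
    rw [hd]
    have h1 : (q : ℝ) ^ s < ⌊(q : ℝ) ^ s⌋₊ + 1 := Nat.lt_floor_add_one _
    have h2 : ((q : ℝ) ^ s) ^ (d + 1) < (⌊(q : ℝ) ^ s⌋₊ + 1 : ℝ) ^ (d + 1) :=
      pow_lt_pow_left₀ h1 (by positivity) (by omega)
    rw [← Real.rpow_natCast, ← Real.rpow_mul (by positivity)] at h2
    have h3 : s * ((d + 1 : ℕ) : ℝ) = 1 := by rw [hs]; push_cast; field_simp
    rw [h3, Real.rpow_one] at h2
    exact_mod_cast h2
  obtain ⟨h1, h2⟩ := hA I hI _ hm v T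
  set m := ⌊(q : ℝ) ^ s⌋₊ with hm'
  rw [← hq, hd] at h1 h2
  have hmq : (m : ℝ) ≤ (q : ℝ) ^ s := Nat.floor_le (by positivity)
  have hqT : (q : ℝ) ^ s ≤ C₀ ^ s * T := by
    have := Real.rpow_le_rpow (by positivity) hT hs0.le
    rw [Real.mul_rpow hC₀.le (by positivity), ← Real.rpow_natCast, ← Real.rpow_mul (by positivity)]
      at this
    have h3 : ((d + 1 : ℕ) : ℝ) * s = 1 := by rw [hs]; push_cast; field_simp
    rwa [h3, Real.rpow_one] at this
  have hT0 : (0 : ℝ) ≤ T := by positivity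
  set e : ℝ := 2 * (A * m) with he
  have he0 : 0 ≤ e := by positivity
  have heq : e ≤ 2 * A * (q : ℝ) ^ s := by
    rw [he, ← mul_assoc]; gcongr
  have heT : e ≤ κ * T := by
    refine heq.trans ?_
    rw [hκ, mul_assoc (2 * (A:ℝ))]; gcongr
  have hU : (q : ℝ) * cnt b I v T ≤ (T + e) ^ (d + 1) := by
    rw [he]; exact_mod_cast h1
  have hκ1 : (1 : ℝ) ≤ (1 + κ) ^ d := one_le_pow₀ (by linarith)
  rw [abs_le]
  constructor
  · set u : ℝ := ((T - 2 * (A * m) : ℕ) : ℝ) with hu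
    have hL : u ^ (d + 1) ≤ (q : ℝ) * cnt b I v T := by
      rw [hu]; exact_mod_cast h2
    have hu0 : 0 ≤ u := by positivity
    have huT : u ≤ T := by rw [hu]; exact_mod_cast Nat.sub_le _ _
    have hue : T - u ≤ e := by
      have : T ≤ (T - 2 * (A * m)) + 2 * (A * m) := by omega
      have : (T : ℝ) ≤ u + e := by rw [hu, he]; exact_mod_cast this
      linarith
    have h3 := aux_pow_sub hu0 huT d
    have h4 : (d + 1) * (T - u) * (T:ℝ) ^ d ≤ (d + 1) * (2 * A) * (1 + κ) ^ d * (q : ℝ) ^ s * T ^ d := by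
      have : T - u ≤ 2 * A * (q : ℝ) ^ s := hue.trans heq
      calc (d + 1) * (T - u) * (T:ℝ) ^ d ≤ (d + 1) * (2 * A * (q : ℝ) ^ s) * T ^ d := by gcongr
        _ = (d + 1) * (2 * A) * 1 * (q : ℝ) ^ s * T ^ d := by ring
        _ ≤ _ := by gcongr
    linarith
  · have h3 := aux_pow_sub hT0 (le_add_of_nonneg_right he0) d
    have h4 : (d + 1) * (T + e - T) * (T + e : ℝ) ^ d ≤
        (d + 1) * (2 * A) * (1 + κ) ^ d * (q : ℝ) ^ s * T ^ d := by
      have : (T + e : ℝ) ≤ (1 + κ) * T := by linarith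
      calc (d + 1) * (T + e - T) * (T + e : ℝ) ^ d = (d + 1) * e * (T + e : ℝ) ^ d := by ring
        _ ≤ (d + 1) * (2 * A * (q : ℝ) ^ s) * ((1 + κ) * T) ^ d := by gcongr
        _ = _ := by rw [mul_pow]; ring
    linarith
end Cnt

theorem aux_theta_pow (d : ℕ) : ∃ C : ℝ, 0 < C ∧ ∀ N : ℕ,
    ∑ p ∈ Nat.primesLE N, Real.log p * (p : ℝ) ^ ((1 : ℝ) / (d + 1)) / p ≤
      C * (N : ℝ) ^ ((1 : ℝ) / (d + 1)) := by
  set s : ℝ := (1 : ℝ) / (d + 1) with hs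
  have hs0 : 0 < s := by positivity
  set h : ℝ := (1 / 2 : ℝ) ^ s with hh
  have hh0 : 0 < h := by positivity
  have hh1 : h < 1 := Real.rpow_lt_one (by norm_num) (by norm_num) hs0
  have hl4 : 0 < Real.log 4 := Real.log_pos (by norm_num)
  set K : ℝ := 2 * Real.log 4 / (1 - h) with hK
  have h1h : 0 < 1 - h := by linarith
  refine ⟨K, by positivity, fun N => ?_⟩
  induction N using Nat.strong_induction_on with
  | _ N ih =>
  rcases Nat.eq_zero_or_pos N with rfl | hN
  · have : Nat.primesLE 0 = ∅ := by ext p; simp [Nat.mem_primesLE]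
    rw [this]; simp; positivity
  have hN' : (0 : ℝ) < N := by exact_mod_cast hN
  have hsub : Nat.primesLE (N / 2) ⊆ Nat.primesLE N := by
    intro p; simp only [Nat.mem_primesLE]; intro h; exact ⟨by omega, h.2⟩
  rw [← Finset.sum_sdiff hsub]
  have h1 : ∑ p ∈ Nat.primesLE (N / 2), Real.log p * (p : ℝ) ^ s / p ≤ K * (h * (N:ℝ) ^ s) := by
    refine (ih (N / 2) (by omega)).trans ?_
    have : ((N / 2 : ℕ) : ℝ) ≤ 1 / 2 * N := by
      have := @Nat.cast_div_le ℝ _ _ _ N 2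
      push_cast at this; linarith
    have h2 := Real.rpow_le_rpow (by positivity) this hs0.le
    rw [Real.mul_rpow (by norm_num) hN'.le] at h2
    gcongr
  have h2 : ∑ p ∈ Nat.primesLE N \ Nat.primesLE (N / 2), Real.log p * (p : ℝ) ^ s / p ≤
      2 * Real.log 4 * (N:ℝ) ^ s := by
    calc _ ≤ ∑ p ∈ Nat.primesLE N \ Nat.primesLE (N / 2), Real.log p * ((N : ℝ) ^ s * (2 / N)) := by
          refine Finset.sum_le_sum fun p hp => ?_
          simp only [Finset.mem_sdiff, Nat.mem_primesLE] at hp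
          have hp2 := hp.1.2.two_le
          have hpN : N / 2 < p := by
            by_contra hcon
            exact hp.2 ⟨by omega, hp.1.2⟩
          have hp0 : (0 : ℝ) < p := by exact_mod_cast (by omega : 0 < p)
          have hpN' : (N : ℝ) ≤ 2 * p := by exact_mod_cast (by omega : N ≤ 2 * p)
          have hple : (p : ℝ) ≤ N := by exact_mod_cast hp.1.1
          rw [mul_div_assoc]
          have hlog : 0 ≤ Real.log p := Real.log_natCast_nonneg p
          have e1 : (1 : ℝ) / p ≤ 2 / N := by
            rw [div_le_div_iff₀ hp0 hN']; linarith
          rw [div_eq_mul_one_div]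
          gcongr
      _ ≤ ∑ p ∈ Nat.primesLE N, Real.log p * ((N : ℝ) ^ s * (2 / N)) := by
          refine Finset.sum_le_sum_of_subset_of_nonneg Finset.sdiff_subset fun p _ _ => ?_
          have hlog : 0 ≤ Real.log p := Real.log_natCast_nonneg p
          positivity
      _ = Chebyshev.theta N * ((N : ℝ) ^ s * (2 / N)) := by
          rw [← Finset.sum_mul, Chebyshev.theta_eq_sum_primesLE_log]
      _ ≤ (Real.log 4 * N) * ((N : ℝ) ^ s * (2 / N)) := by
          have := Chebyshev.theta_le_log4_mul_x hN'.le
          gcongr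
      _ = _ := by field_simp
  have h3 : K * (1 - h) = 2 * Real.log 4 := by rw [hK]; field_simp
  have : K * (N:ℝ) ^ s = 2 * Real.log 4 * (N:ℝ) ^ s + K * (h * (N:ℝ) ^ s) := by
    rw [← h3]; ring
  linarith
end Part2

section Part3
open Filter

set_option linter.unusedSectionVars false
section Primes
variable {R : Type*} [CommRing R] [IsDedekindDomain R] [Module.Free ℤ R] [Module.Finite ℤ R]
  [CharZero R]

/-- Nonzero prime ideals of norm at most `Y`. -/
noncomputable def pset (R : Type*) [CommRing R] [IsDedekindDomain R] [Module.Free ℤ R]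
    [Module.Finite ℤ R] [CharZero R] (Y : ℕ) : Finset (Ideal R) :=
  ((Ideal.finite_setOfPred_absNorm_le (S := R) Y).subset
    (t := {P : Ideal R | P.IsPrime ∧ P ≠ ⊥ ∧ Ideal.absNorm P ≤ Y}) (fun _ h => h.2.2)).toFinset

theorem mem_pset {Y : ℕ} {P : Ideal R} :
    P ∈ pset R Y ↔ P.IsPrime ∧ P ≠ ⊥ ∧ Ideal.absNorm P ≤ Y := by
  simp [pset]

theorem two_le_norm {P : Ideal R} (hP : P.IsPrime) (h0 : P ≠ ⊥) : 2 ≤ Ideal.absNorm P := by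
  have h1 : Ideal.absNorm P ≠ 0 := by rwa [Ne, Ideal.absNorm_eq_zero_iff]
  have h2 : Ideal.absNorm P ≠ 1 := by
    rw [Ne, Ideal.absNorm_eq_one_iff]; exact hP.ne_top
  omega

open Classical in
theorem log_norm_eq (J : Ideal R) (hJ : J ≠ ⊥) (Y : ℕ) (hY : Ideal.absNorm J ≤ Y) :
    Real.log (Ideal.absNorm J) = ∑ P ∈ pset R Y, ∑ k ∈ Finset.Icc 1 Y,
      if J ≤ P ^ k then Real.log (Ideal.absNorm P) else 0 := by
  have hJ0 : J ≠ 0 := hJ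
  set F := UniqueFactorizationMonoid.normalizedFactors J with hF
  have hprod : F.prod = J := by
    rw [hF]; exact associated_iff_eq.mp (UniqueFactorizationMonoid.prod_normalizedFactors hJ0)
  have hJpos : 0 < Ideal.absNorm J := by
    have : Ideal.absNorm J ≠ 0 := by rwa [Ne, Ideal.absNorm_eq_zero_iff]
    omega
  have hcount : ∀ P ∈ pset R Y, ∀ k, J ≤ P ^ k ↔ k ≤ F.count P := by
    intro P hP k
    rw [mem_pset] at hP
    have hPp : Prime P := Ideal.prime_of_isPrime hP.2.1 hP.1
    rw [← Ideal.dvd_iff_le, pow_dvd_iff_le_emultiplicity,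
      UniqueFactorizationMonoid.emultiplicity_eq_count_normalizedFactors hPp.irreducible hJ0,
      normalize_eq]
    simp [hF]
  have hsub : F.toFinset ⊆ pset R Y := by
    intro P hP
    rw [Multiset.mem_toFinset] at hP
    have hPp := UniqueFactorizationMonoid.prime_of_normalized_factor P hP
    have hdvd := UniqueFactorizationMonoid.dvd_of_mem_normalizedFactors hP
    rw [mem_pset]
    refine ⟨Ideal.isPrime_of_prime hPp, hPp.ne_zero, ?_⟩
    exact (Nat.le_of_dvd hJpos (map_dvd Ideal.absNorm hdvd)).trans hY
  have hinner : ∀ P ∈ pset R Y, (∑ k ∈ Finset.Icc 1 Y,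
      if J ≤ P ^ k then Real.log (Ideal.absNorm P) else 0) =
      F.count P * Real.log (Ideal.absNorm P) := by
    intro P hP
    have hP2 := two_le_norm (mem_pset.mp hP).1 (mem_pset.mp hP).2.1
    rw [← Finset.sum_filter, Finset.sum_const, nsmul_eq_mul]
    congr 2
    have : (Finset.Icc 1 Y).filter (fun k => J ≤ P ^ k) = Finset.Icc 1 (F.count P) := by
      ext k
      simp only [Finset.mem_filter, Finset.mem_Icc, hcount P hP]
      constructor
      · rintro ⟨h1, h2⟩; exact ⟨h1.1, h2⟩
      · rintro ⟨h1, h2⟩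
        refine ⟨⟨h1, ?_⟩, h2⟩
        have h3 : J ≤ P ^ k := (hcount P hP k).mpr h2
        have h4 := Nat.le_of_dvd hJpos (Ideal.absNorm_dvd_absNorm_of_le h3)
        rw [map_pow] at h4
        have h5 : 2 ^ k ≤ Ideal.absNorm P ^ k := Nat.pow_le_pow_left hP2 k
        have h6 := @Nat.lt_two_pow_self k
        omega
    rw [this]; simp
  rw [Finset.sum_congr rfl hinner]
  conv_lhs => rw [← hprod]
  rw [Finset.prod_multiset_count, map_prod]
  simp only [map_pow]
  push_cast
  rw [Real.log_prod]
  · rw [← Finset.sum_subset hsub]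
    · simp [Real.log_pow]
    · intro P _ hP
      rw [Multiset.mem_toFinset] at hP
      simp [Multiset.count_eq_zero_of_notMem hP]
  · intro P hP
    have := two_le_norm (mem_pset.mp (hsub hP)).1 (mem_pset.mp (hsub hP)).2.1
    have : (Ideal.absNorm P : ℝ) ≠ 0 := by exact_mod_cast (by omega : Ideal.absNorm P ≠ 0)
    exact pow_ne_zero _ this

theorem card_above (p : ℕ) (hp : p.Prime) (s : Finset (Ideal R))
    (hs : ∀ P ∈ s, P.IsPrime ∧ P ≠ ⊥ ∧ (p : R) ∈ P) : s.card ≤ Module.finrank ℤ R := by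
  have hdvd : ∏ P ∈ s, P ∣ Ideal.span {(p : R)} := by
    refine Finset.prod_primes_dvd _ (fun P hP => Ideal.prime_of_isPrime (hs P hP).2.1 (hs P hP).1) ?_
    intro P hP
    rw [Ideal.dvd_iff_le, Ideal.span_singleton_le_iff_mem]
    exact (hs P hP).2.2
  have h1 : ∏ P ∈ s, Ideal.absNorm P ∣ p ^ Module.finrank ℤ R := by
    rw [← Ideal.absNorm_span_natCast, ← map_prod]
    exact map_dvd _ hdvd
  have h2 : ∀ P ∈ s, p ≤ Ideal.absNorm P := by
    intro P hP
    have hP2 := two_le_norm (hs P hP).1 (hs P hP).2.1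
    have h3 : Ideal.absNorm P ∣ p ^ Module.finrank ℤ R := by
      rw [← Ideal.absNorm_span_natCast]
      exact Ideal.absNorm_dvd_absNorm_of_le
        ((Ideal.span_singleton_le_iff_mem _).mpr (hs P hP).2.2)
    obtain ⟨k, _, hk⟩ := (Nat.dvd_prime_pow hp).mp h3
    rw [hk] at hP2 ⊢
    rcases Nat.eq_zero_or_pos k with rfl | hk0
    · simp at hP2
    · exact Nat.le_self_pow hk0.ne' p
  have h3 : p ^ s.card ≤ p ^ Module.finrank ℤ R := by
    calc p ^ s.card = ∏ P ∈ s, p := by simp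
      _ ≤ ∏ P ∈ s, Ideal.absNorm P := Finset.prod_le_prod' h2
      _ ≤ _ := Nat.le_of_dvd (pow_pos hp.pos _) h1
  exact (Nat.pow_le_pow_iff_right hp.one_lt).mp h3

theorem norm_minFac {P : Ideal R} (hP : P.IsPrime) (h0 : P ≠ ⊥) :
    (Ideal.absNorm P).minFac.Prime ∧ ((Ideal.absNorm P).minFac : R) ∈ P ∧
    (¬ (Ideal.absNorm P).Prime → (Ideal.absNorm P).minFac ^ 2 ≤ Ideal.absNorm P) := by
  have h2 := two_le_norm hP h0
  have hmax : P.IsMaximal := hP.isMaximal h0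
  have h1 : Ideal.absNorm P ≠ 1 := by omega
  refine ⟨Nat.minFac_prime h1, ?_, fun h => Nat.minFac_sq_le_self (by omega) h⟩
  obtain ⟨p, n, hn0, hmem, hp, h⟩ := Ideal.exists_prime_and_absNorm_eq_pow P
  rw [h, hp.pow_minFac hn0.ne']
  exact hmem

theorem aux_geom {r : ℝ} (hr0 : 0 ≤ r) (hr : r ≤ 1 / 2) (a Y : ℕ) :
    ∑ k ∈ Finset.Icc a Y, r ^ k ≤ 2 * r ^ a := by
  have h1 : ∑ k ∈ Finset.Icc a Y, r ^ k = ∑ k ∈ Finset.Ico a (Y+1), r ^ k := by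
    congr 1
  rw [h1]
  have := geom_sum_Ico_le_of_lt_one (m := a) (n := Y+1) hr0 (by linarith)
  refine this.trans ?_
  rw [div_le_iff₀ (by linarith)]
  nlinarith [pow_nonneg hr0 a]

open Classical in
theorem bad_one {P : Ideal R} (hP : P.IsPrime) (h0 : P ≠ ⊥) (Y : ℕ) :
    ∑ k ∈ Finset.Icc 1 Y, (if k = 1 ∧ (Ideal.absNorm P).Prime then 0 else
      Real.log (Ideal.absNorm P) / (Ideal.absNorm P : ℝ) ^ k) ≤
      8 * (1 / ((Ideal.absNorm P).minFac : ℝ) ^ (3 / 2 : ℝ)) := by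
  obtain ⟨hp, hmem, hsq⟩ := norm_minFac hP h0
  have h2 := two_le_norm hP h0
  set q := Ideal.absNorm P with hq
  have hq2 : (2 : ℝ) ≤ q := by exact_mod_cast h2
  have hq0 : (0 : ℝ) < q := by linarith
  have hlogn : 0 ≤ Real.log q := Real.log_natCast_nonneg q
  have hlog : Real.log q ≤ 4 * (q : ℝ) ^ (1 / 4 : ℝ) := by
    have := Real.log_le_rpow_div hq0.le (ε := 1 / 4) (by norm_num)
    linarith
  have hr0 : (0 : ℝ) ≤ 1 / q := by positivity
  have hr : (1 : ℝ) / q ≤ 1 / 2 := one_div_le_one_div_of_le (by norm_num) hq2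
  have hterm : ∀ k, Real.log q / (q : ℝ) ^ k = Real.log q * (1 / q : ℝ) ^ k := by
    intro k; rw [one_div, inv_pow, div_eq_mul_inv]
  by_cases hpr : q.Prime
  · rw [hpr.minFac_eq]
    calc _ ≤ ∑ k ∈ Finset.Icc 2 Y, Real.log q * (1 / q : ℝ) ^ k := by
          rw [← Finset.sum_subset (s₁ := Finset.Icc 2 Y)
            (Finset.Icc_subset_Icc (by norm_num) le_rfl)]
          · refine Finset.sum_le_sum fun k hk => ?_
            rw [if_neg, hterm]
            rintro ⟨rfl, _⟩
            simp at hk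
          · intro k hk hk'
            rw [if_pos]
            simp at hk hk'
            exact ⟨by omega, hpr⟩
      _ ≤ Real.log q * (2 * (1 / q : ℝ) ^ 2) := by
          rw [← Finset.mul_sum]
          exact mul_le_mul_of_nonneg_left (aux_geom hr0 hr 2 Y) hlogn
      _ ≤ (4 * (q : ℝ) ^ (1 / 4 : ℝ)) * (2 * (1 / q : ℝ) ^ 2) := by gcongr
      _ ≤ (4 * (q : ℝ) ^ (1 / 2 : ℝ)) * (2 * (1 / q : ℝ) ^ 2) := by
          gcongr
          · linarith
          · norm_num
      _ = 8 * (1 / (q : ℝ) ^ (3 / 2 : ℝ)) := by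
          have : (q : ℝ) ^ (2 : ℕ) = (q : ℝ) ^ (1 / 2 : ℝ) * (q : ℝ) ^ (3 / 2 : ℝ) := by
            rw [← Real.rpow_add hq0, ← Real.rpow_natCast]; norm_num
          rw [div_pow, one_pow, this]
          field_simp
          norm_num
  · have hsq' : ((q.minFac : ℝ)) ^ 2 ≤ q := by exact_mod_cast hsq hpr
    have hp0 : (0 : ℝ) < q.minFac := by exact_mod_cast hp.pos
    calc _ ≤ ∑ k ∈ Finset.Icc 1 Y, Real.log q * (1 / q : ℝ) ^ k := by
          refine Finset.sum_le_sum fun k hk => ?_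
          rw [if_neg (fun h => hpr h.2), hterm]
      _ ≤ Real.log q * (2 * (1 / q : ℝ) ^ 1) := by
          rw [← Finset.mul_sum]
          exact mul_le_mul_of_nonneg_left (aux_geom hr0 hr 1 Y) hlogn
      _ ≤ (4 * (q : ℝ) ^ (1 / 4 : ℝ)) * (2 * (1 / q : ℝ) ^ 1) := by gcongr
      _ = 8 * (1 / (q : ℝ) ^ (3 / 4 : ℝ)) := by
          have : (q : ℝ) = (q : ℝ) ^ (1 / 4 : ℝ) * (q : ℝ) ^ (3 / 4 : ℝ) := by
            rw [← Real.rpow_add hq0]; norm_num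
          rw [pow_one]
          nth_rewrite 2 [this]
          field_simp
          norm_num
      _ ≤ 8 * (1 / (q.minFac : ℝ) ^ (3 / 2 : ℝ)) := by
          have h5 : (q.minFac : ℝ) ^ (3 / 2 : ℝ) ≤ (q : ℝ) ^ (3 / 4 : ℝ) := by
            have := Real.rpow_le_rpow (by positivity) hsq' (z := 3 / 4) (by norm_num)
            rw [← Real.rpow_natCast, ← Real.rpow_mul hp0.le] at this
            norm_num at this
            exact this
          gcongr

open Classical in
theorem bad_sum (R : Type*) [CommRing R] [IsDedekindDomain R] [Module.Free ℤ R]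
    [Module.Finite ℤ R] [CharZero R] : ∃ B : ℝ, 0 ≤ B ∧ ∀ Y : ℕ,
    ∑ P ∈ pset R Y, ∑ k ∈ Finset.Icc 1 Y, (if k = 1 ∧ (Ideal.absNorm P).Prime then 0 else
      Real.log (Ideal.absNorm P) / (Ideal.absNorm P : ℝ) ^ k) ≤ B := by
  have hsum : Summable (fun n : ℕ => 1 / (n : ℝ) ^ (3 / 2 : ℝ)) :=
    Real.summable_one_div_nat_rpow.mpr (by norm_num)
  refine ⟨Module.finrank ℤ R * (8 * ∑' n : ℕ, 1 / (n : ℝ) ^ (3 / 2 : ℝ)),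
    mul_nonneg (by positivity) (mul_nonneg (by norm_num) (tsum_nonneg fun n => by positivity)),
    fun Y => ?_⟩
  calc _ ≤ ∑ P ∈ pset R Y, 8 * (1 / ((Ideal.absNorm P).minFac : ℝ) ^ (3 / 2 : ℝ)) :=
        Finset.sum_le_sum fun P hP => bad_one (mem_pset.mp hP).1 (mem_pset.mp hP).2.1 Y
    _ = ∑ n ∈ Finset.range (Y + 1), ∑ P ∈ pset R Y with (Ideal.absNorm P).minFac = n,
          8 * (1 / ((Ideal.absNorm P).minFac : ℝ) ^ (3 / 2 : ℝ)) := by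
        rw [Finset.sum_fiberwise_of_maps_to]
        intro P hP
        have h2 := two_le_norm (mem_pset.mp hP).1 (mem_pset.mp hP).2.1
        have h3 := (mem_pset.mp hP).2.2
        have := Nat.minFac_le (n := Ideal.absNorm P) (by omega)
        simp; omega
    _ ≤ ∑ n ∈ Finset.range (Y + 1), Module.finrank ℤ R * (8 * (1 / (n : ℝ) ^ (3 / 2 : ℝ))) := by
        refine Finset.sum_le_sum fun n _ => ?_
        calc _ = ∑ P ∈ pset R Y with (Ideal.absNorm P).minFac = n,
            8 * (1 / (n : ℝ) ^ (3 / 2 : ℝ)) := by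
              refine Finset.sum_congr rfl fun P hP => ?_
              rw [(Finset.mem_filter.mp hP).2]
          _ = ((pset R Y).filter (fun P => (Ideal.absNorm P).minFac = n)).card *
            (8 * (1 / (n : ℝ) ^ (3 / 2 : ℝ))) := by rw [Finset.sum_const, nsmul_eq_mul]
          _ ≤ _ := by
            gcongr
            rcases Finset.eq_empty_or_nonempty
              ((pset R Y).filter (fun P => (Ideal.absNorm P).minFac = n)) with h | ⟨P, hP⟩
            · rw [h]; simp
            · rw [Finset.mem_filter, mem_pset] at hP
              have hn : n.Prime := by
                rw [← hP.2]; exact (norm_minFac hP.1.1 hP.1.2.1).1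
              refine card_above n hn _ fun Q hQ => ?_
              rw [Finset.mem_filter, mem_pset] at hQ
              refine ⟨hQ.1.1, hQ.1.2.1, ?_⟩
              have := (norm_minFac hQ.1.1 hQ.1.2.1).2.1
              rwa [hQ.2] at this
    _ ≤ _ := by
        rw [← Finset.mul_sum, ← Finset.mul_sum]
        gcongr
        exact hsum.sum_le_tsum _ fun n _ => by positivity
end Primes
end Part3

section Part4
open Filter NumberField

theorem box_norm (K : Type*) [Field K] [NumberField K] {ι : Type*} [Fintype ι] [DecidableEq ι]
    (b : Module.Basis ι ℤ (𝓞 K)) (d : ℕ) (hd : Module.finrank ℚ K = d + 1) :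
    ∃ C₀ : ℕ, 0 < C₀ ∧ ∀ T : ℕ, 0 < T → ∃ v : ι → ℤ, ∀ a ∈ cbox v T,
      T ^ (d + 1) ≤ Ideal.absNorm (Ideal.span {b.equivFun.symm a}) ∧
      Ideal.absNorm (Ideal.span {b.equivFun.symm a}) ≤ C₀ * T ^ (d + 1) := by
  classical
  set B : ℝ := ∑ σ : K →ₐ[ℚ] ℂ, ∑ i, ‖σ (b i : K)‖ with hB
  have hB0 : 0 ≤ B := by positivity
  set M : ℕ := ⌈B⌉₊ + 1 with hM
  have hBM : B + 1 ≤ M := by rw [hM]; push_cast; linarith [Nat.le_ceil B]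
  refine ⟨(2 * M) ^ (d + 1), by positivity, fun T hT => ?_⟩
  refine ⟨fun i => (T * M : ℤ) * b.repr 1 i, fun a ha => ?_⟩
  rw [mem_cbox] at ha
  set g := b.equivFun.symm a with hg
  have hT0 : (0 : ℝ) < T := by exact_mod_cast hT
  have hgeq : (g : K) = (T * M : ℕ) + ∑ i, ((a i - (T * M : ℤ) * b.repr 1 i : ℤ) : K) * (b i : K) := by
    have h1 : g = ((T * M : ℕ) : 𝓞 K) +
        ∑ i, ((a i - (T * M : ℤ) * b.repr 1 i : ℤ) : 𝓞 K) * b i := by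
      have h2 : ((T * M : ℕ) : 𝓞 K) = ∑ i, (((T * M : ℤ) * b.repr 1 i : ℤ) : 𝓞 K) * b i := by
        conv_lhs => rw [← mul_one ((T * M : ℕ) : 𝓞 K), ← b.sum_repr 1, Finset.mul_sum]
        refine Finset.sum_congr rfl fun i _ => ?_
        rw [zsmul_eq_mul]; push_cast; ring
      rw [h2, ← Finset.sum_add_distrib, hg, b.equivFun_symm_apply]
      refine Finset.sum_congr rfl fun i _ => ?_
      rw [zsmul_eq_mul]; push_cast; ring
    rw [h1]
    simp only [map_add, map_sum, map_mul, map_natCast, map_intCast]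
  have hσ : ∀ σ : K →ₐ[ℚ] ℂ, (T : ℝ) ≤ ‖σ g‖ ∧ ‖σ g‖ ≤ (2 * M) * T := by
    intro σ
    set w : ℂ := ∑ i, ((a i - (T * M : ℤ) * b.repr 1 i : ℤ) : ℂ) * σ (b i : K) with hw
    have h1 : σ g = (T * M : ℕ) + w := by
      rw [hgeq]; simp only [map_add, map_sum, map_mul, map_natCast, map_intCast, hw]
    have hwB : ‖w‖ ≤ T * B := by
      calc ‖w‖ ≤ ∑ i, ‖((a i - (T * M : ℤ) * b.repr 1 i : ℤ) : ℂ) * σ (b i : K)‖ := norm_sum_le _ _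
        _ ≤ ∑ i, (T : ℝ) * ‖σ (b i : K)‖ := by
            refine Finset.sum_le_sum fun i _ => ?_
            rw [norm_mul]
            gcongr
            rw [Complex.norm_intCast]
            have h := ha i
            rw [abs_of_nonneg (by exact_mod_cast (by omega :
              0 ≤ a i - (T * M : ℤ) * b.repr 1 i))]
            exact_mod_cast (by omega : a i - (T * M : ℤ) * b.repr 1 i ≤ T)
        _ = T * ∑ i, ‖σ (b i : K)‖ := by rw [Finset.mul_sum]
        _ ≤ T * B := by
            gcongr
            exact Finset.single_le_sum (f := fun σ : K →ₐ[ℚ] ℂ => ∑ i, ‖σ (b i : K)‖)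
              (fun _ _ => by positivity) (Finset.mem_univ σ)
    have hTM : ‖((T * M : ℕ) : ℂ)‖ = T * M := by rw [Complex.norm_natCast]; push_cast; rfl
    have hTB : (T : ℝ) * (B + 1) ≤ T * M := by gcongr
    rw [h1]
    constructor
    · have := norm_sub_le (((T * M : ℕ) : ℂ) + w) w
      rw [add_sub_cancel_right, hTM] at this
      linarith
    · have := norm_add_le ((T * M : ℕ) : ℂ) w
      rw [hTM] at this
      linarith
  have hN : (Ideal.absNorm (Ideal.span {g}) : ℝ) = ∏ σ : K →ₐ[ℚ] ℂ, ‖σ g‖ := by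
    rw [Ideal.absNorm_span_singleton, Nat.cast_natAbs, ← norm_prod,
      ← Algebra.norm_eq_prod_embeddings ℚ ℂ (g : K), ← Algebra.coe_norm_int]
    simp
  have hcardσ : (Finset.univ : Finset (K →ₐ[ℚ] ℂ)).card = d + 1 := by
    rw [Finset.card_univ, AlgHom.card, hd]
  constructor
  · have : (T : ℝ) ^ (d + 1) ≤ Ideal.absNorm (Ideal.span {g}) := by
      rw [hN, ← hcardσ, ← Finset.prod_const]
      exact Finset.prod_le_prod (fun _ _ => hT0.le) fun σ _ => (hσ σ).1
    exact_mod_cast this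
  · have : (Ideal.absNorm (Ideal.span {g}) : ℝ) ≤ (2 * M) ^ (d + 1) * T ^ (d + 1) := by
      rw [hN, ← mul_pow, ← hcardσ, ← Finset.prod_const]
      exact Finset.prod_le_prod (fun _ _ => norm_nonneg _) fun σ _ => (hσ σ).2
    exact_mod_cast this

/-- The sum over primes of degree one. -/
noncomputable def M1 (R : Type*) [CommRing R] [IsDedekindDomain R] [Module.Free ℤ R]
    [Module.Finite ℤ R] [CharZero R] (Y : ℕ) : ℝ :=
  ∑ P ∈ (pset R Y).filter (fun P => (Ideal.absNorm P).Prime),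
    Real.log (Ideal.absNorm P) / (Ideal.absNorm P : ℝ)

theorem deg_one_sum_le (R : Type*) [CommRing R] [IsDedekindDomain R] [Module.Free ℤ R]
    [Module.Finite ℤ R] [CharZero R] (Y : ℕ) (f : ℕ → ℝ) (hf : ∀ n, 0 ≤ f n) :
    ∑ P ∈ (pset R Y).filter (fun P => (Ideal.absNorm P).Prime), f (Ideal.absNorm P) ≤
      Module.finrank ℤ R * ∑ p ∈ Nat.primesLE Y, f p := by
  classical
  rw [← Finset.sum_fiberwise_of_maps_to (s := (pset R Y).filter (fun P => (Ideal.absNorm P).Prime))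
    (t := Nat.primesLE Y) (g := fun P => Ideal.absNorm P), Finset.mul_sum]
  · refine Finset.sum_le_sum fun p hp => ?_
    rw [Nat.mem_primesLE] at hp
    rw [Finset.sum_congr rfl (g := fun _ => f p)
      (fun P hP => by rw [(Finset.mem_filter.mp hP).2]), Finset.sum_const, nsmul_eq_mul]
    refine mul_le_mul_of_nonneg_right ?_ (hf p)
    norm_cast
    refine card_above p hp.2 _ fun P hP => ?_
    simp only [Finset.mem_filter, mem_pset] at hP
    refine ⟨hP.1.1.1, hP.1.1.2.1, ?_⟩
    have := Ideal.absNorm_mem P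
    rwa [hP.2] at this
  · intro P hP
    rw [Finset.mem_filter, mem_pset] at hP
    exact Nat.mem_primesLE.mpr ⟨hP.1.2.2, hP.2⟩

theorem main1 (K : Type*) [Field K] [NumberField K] (d : ℕ) (hd : Module.finrank ℚ K = d + 1) :
    ∃ C₀ : ℕ, 0 < C₀ ∧ ∃ C : ℝ, ∀ T : ℕ, 0 < T →
      |M1 (𝓞 K) (C₀ * T ^ (d + 1)) - (d + 1) * Real.log T| ≤ C := by
  classical
  let b := RingOfIntegers.basis K
  have hcard : Fintype.card (Module.Free.ChooseBasisIndex ℤ (𝓞 K)) = d + 1 := by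
    rw [← Module.finrank_eq_card_basis b, RingOfIntegers.rank, hd]
  have hrank : Module.finrank ℤ (𝓞 K) = d + 1 := by rw [RingOfIntegers.rank, hd]
  obtain ⟨C₀, hC₀, hbox⟩ := box_norm K b d hd
  have hC₀' : (0 : ℝ) < C₀ := by exact_mod_cast hC₀
  have hC₀1 : (1 : ℝ) ≤ C₀ := by exact_mod_cast hC₀
  obtain ⟨C₁, hC₁, hcnt⟩ := aux_count_real b d hcard C₀ hC₀'
  obtain ⟨C₂, hC₂, hth⟩ := aux_theta_pow d
  obtain ⟨B, hB, hbad⟩ := bad_sum (𝓞 K)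
  set s : ℝ := (1 : ℝ) / (d + 1) with hs
  have hs0 : 0 < s := by positivity
  set C₃ : ℝ := 1 + C₁ * C₀ ^ s with hC₃
  have hC₃0 : 0 ≤ C₃ := by positivity
  set C₄ : ℝ := C₁ * ((d + 1) * (C₂ * C₀ ^ s)) with hC₄
  refine ⟨C₀, hC₀, Real.log C₀ + C₃ * B + C₄, fun T hT => ?_⟩
  obtain ⟨v, hv⟩ := hbox T hT
  set Y := C₀ * T ^ (d + 1) with hY
  have hT0 : (0 : ℝ) < T := by exact_mod_cast hT
  set n : ℝ := (T : ℝ) ^ (d + 1) with hn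
  have hn0 : 0 < n := by positivity
  have hYr : (Y : ℝ) = C₀ * n := by rw [hY, hn]; push_cast; rfl
  have hY1 : 1 ≤ Y := by
    have : 0 < Y := by positivity
    omega
  have hpowT : ∀ q : ℝ, 0 ≤ q → q ≤ Y → q ^ s ≤ C₀ ^ s * T := by
    intro q hq0 hq
    have := Real.rpow_le_rpow hq0 hq hs0.le
    rw [hYr, Real.mul_rpow hC₀'.le hn0.le, hn, ← Real.rpow_natCast, ← Real.rpow_mul hT0.le] at this
    have h3 : ((d + 1 : ℕ) : ℝ) * s = 1 := by rw [hs]; push_cast; field_simp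
    rwa [h3, Real.rpow_one] at this
  have hgne : ∀ a ∈ cbox v T, Ideal.span {b.equivFun.symm a} ≠ ⊥ := by
    intro a ha h
    have := (hv a ha).1
    rw [h, Ideal.absNorm_bot] at this
    have : 0 < T ^ (d + 1) := by positivity
    omega
  -- the total
  set E : ℝ := ∑ a ∈ cbox v T, Real.log (Ideal.absNorm (Ideal.span {b.equivFun.symm a})) with hE
  have hcb : ((cbox v T).card : ℝ) = n := by rw [card_cbox, hcard, hn]; push_cast; rfl
  have hlogT : ∀ x : ℝ, n ≤ x → (d + 1) * Real.log T ≤ Real.log x := by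
    intro x hx
    have := Real.log_le_log hn0 hx
    rw [hn, Real.log_pow] at this
    push_cast at this; exact this
  have hE1 : n * ((d + 1) * Real.log T) ≤ E := by
    rw [← hcb, ← nsmul_eq_mul, ← Finset.sum_const]
    refine Finset.sum_le_sum fun a ha => hlogT _ ?_
    rw [hn]; exact_mod_cast (hv a ha).1
  have hE2 : E ≤ n * ((d + 1) * Real.log T + Real.log C₀) := by
    rw [← hcb, ← nsmul_eq_mul, ← Finset.sum_const]
    refine Finset.sum_le_sum fun a ha => ?_
    have h1 := (hv a ha).1
    have h2 := (hv a ha).2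
    have h3 : (0 : ℝ) < Ideal.absNorm (Ideal.span {b.equivFun.symm a}) := by
      have : 0 < T ^ (d + 1) := by positivity
      exact_mod_cast (by omega : 0 < Ideal.absNorm (Ideal.span {b.equivFun.symm a}))
    have h4 : (Ideal.absNorm (Ideal.span {b.equivFun.symm a}) : ℝ) ≤ C₀ * (T : ℝ) ^ (d + 1) := by
      exact_mod_cast h2
    have := Real.log_le_log h3 h4
    rw [Real.log_mul hC₀'.ne' (by positivity), Real.log_pow] at this
    push_cast at this
    linarith
  have hEsum : E = ∑ P ∈ pset (𝓞 K) Y, ∑ k ∈ Finset.Icc 1 Y,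
      Real.log (Ideal.absNorm P) * cnt b (P ^ k) v T := by
    rw [hE, Finset.sum_congr rfl fun a ha =>
      log_norm_eq (Ideal.span {b.equivFun.symm a}) (hgne a ha) Y (hv a ha).2]
    rw [Finset.sum_comm]
    refine Finset.sum_congr rfl fun P _ => ?_
    rw [Finset.sum_comm]
    refine Finset.sum_congr rfl fun k _ => ?_
    simp only [Ideal.span_singleton_le_iff_mem]
    rw [← Finset.sum_filter, Finset.sum_const, nsmul_eq_mul, cnt, mul_comm]
  set G : ℝ := ∑ P ∈ (pset (𝓞 K) Y).filter (fun P => (Ideal.absNorm P).Prime),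
      Real.log (Ideal.absNorm P) * cnt b P v T with hG
  set D : ℝ := ∑ P ∈ pset (𝓞 K) Y, ∑ k ∈ Finset.Icc 1 Y,
      (if k = 1 ∧ (Ideal.absNorm P).Prime then 0 else
        Real.log (Ideal.absNorm P) * cnt b (P ^ k) v T) with hD
  have hEGD : E = G + D := by
    rw [hEsum, hG, hD, Finset.sum_filter, ← Finset.sum_add_distrib]
    refine Finset.sum_congr rfl fun P _ => ?_
    by_cases hp : (Ideal.absNorm P).Prime
    · have h1 : (1 : ℕ) ∈ Finset.Icc 1 Y := by simp [hY1]
      rw [if_pos hp, ← Finset.add_sum_erase _ _ h1, ← Finset.add_sum_erase _ _ h1,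
        if_pos ⟨rfl, hp⟩, pow_one, zero_add]
      congr 1
      refine Finset.sum_congr rfl fun k hk => ?_
      rw [if_neg]
      exact fun h => (Finset.mem_erase.mp hk).1 h.1
    · rw [if_neg hp, zero_add]
      refine Finset.sum_congr rfl fun k hk => ?_
      rw [if_neg (fun h => hp h.2)]
  have hlogP : ∀ P : Ideal (𝓞 K), 0 ≤ Real.log (Ideal.absNorm P) := fun P =>
    Real.log_natCast_nonneg _
  have hD0 : 0 ≤ D := by
    refine Finset.sum_nonneg fun P _ => Finset.sum_nonneg fun k _ => ?_
    split_ifs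
    · exact le_rfl
    · exact mul_nonneg (hlogP P) (by positivity)
  have hcntle : ∀ I : Ideal (𝓞 K), I ≠ ⊥ → (cnt b I v T : ℝ) ≤ C₃ * n / Ideal.absNorm I := by
    intro I hI
    have hI0 : (0 : ℝ) < Ideal.absNorm I := by
      have : Ideal.absNorm I ≠ 0 := by rwa [Ne, Ideal.absNorm_eq_zero_iff]
      exact_mod_cast Nat.pos_of_ne_zero this
    by_cases hle : Ideal.absNorm I ≤ Y
    · have hle' : (Ideal.absNorm I : ℝ) ≤ Y := by exact_mod_cast hle
      have h1 := (abs_le.mp (hcnt I hI v T (by rw [← hn, ← hYr]; exact hle'))).2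
      have h2 := hpowT _ hI0.le hle'
      rw [le_div_iff₀ hI0]
      have h3 : C₁ * (Ideal.absNorm I : ℝ) ^ s * T ^ d ≤ C₁ * (C₀ ^ s * T) * T ^ d := by gcongr
      have h4 : C₁ * (C₀ ^ s * T) * T ^ d = C₁ * C₀ ^ s * n := by rw [hn]; ring
      rw [← hn] at h1
      rw [hC₃]; linarith
    · have : cnt b I v T = 0 := by
        rw [cnt, Finset.card_eq_zero, Finset.filter_eq_empty_iff]
        intro a ha hmem
        have h1 : Ideal.absNorm I ≤ Ideal.absNorm (Ideal.span {b.equivFun.symm a}) := by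
          refine Nat.le_of_dvd ?_ (Ideal.absNorm_dvd_absNorm_of_le
            ((Ideal.span_singleton_le_iff_mem _).mpr hmem))
          have := (hv a ha).1
          have : 0 < T ^ (d + 1) := by positivity
          omega
        have := (hv a ha).2
        omega
      rw [this]; simp only [Nat.cast_zero]; positivity
  have hD1 : D ≤ C₃ * n * B := by
    refine le_trans ?_ (mul_le_mul_of_nonneg_left (hbad Y) (by positivity))
    rw [hD, Finset.mul_sum]
    refine Finset.sum_le_sum fun P hP => ?_
    rw [Finset.mul_sum]
    refine Finset.sum_le_sum fun k _ => ?_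
    split_ifs
    · simp
    · have := hcntle (P ^ k) (pow_ne_zero k (mem_pset.mp hP).2.1)
      rw [map_pow] at this
      push_cast at this
      have h2 := mul_le_mul_of_nonneg_left this (hlogP P)
      refine h2.trans (le_of_eq ?_)
      ring
  have hG1 : |G - n * M1 (𝓞 K) Y| ≤ C₄ * n := by
    rw [hG, M1, Finset.mul_sum, ← Finset.sum_sub_distrib]
    refine (Finset.abs_sum_le_sum_abs _ _).trans ?_
    calc _ ≤ ∑ P ∈ (pset (𝓞 K) Y).filter (fun P => (Ideal.absNorm P).Prime), (C₁ * T ^ d) *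
          (Real.log (Ideal.absNorm P) * (Ideal.absNorm P : ℝ) ^ s / (Ideal.absNorm P : ℝ)) := by
          refine Finset.sum_le_sum fun P hP => ?_
          rw [Finset.mem_filter, mem_pset] at hP
          have hP0 : (0 : ℝ) < Ideal.absNorm P := by exact_mod_cast hP.2.pos
          have hle' : (Ideal.absNorm P : ℝ) ≤ Y := by exact_mod_cast hP.1.2.2
          have h1 := hcnt P hP.1.2.1 v T (by rw [← hn, ← hYr]; exact hle')
          rw [← hn] at h1
          have h2 : Real.log (Ideal.absNorm P) * cnt b P v T -
              n * (Real.log (Ideal.absNorm P) / (Ideal.absNorm P : ℝ)) =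
              (Real.log (Ideal.absNorm P) / (Ideal.absNorm P : ℝ)) *
              ((Ideal.absNorm P : ℝ) * cnt b P v T - n) := by field_simp
          have h3 : 0 ≤ Real.log (Ideal.absNorm P) / (Ideal.absNorm P : ℝ) :=
            div_nonneg (hlogP P) hP0.le
          rw [h2, abs_mul, abs_of_nonneg h3]
          refine (mul_le_mul_of_nonneg_left h1 h3).trans (le_of_eq ?_)
          ring
      _ ≤ (C₁ * T ^ d) * ((d + 1) * (C₂ * (C₀ ^ s * T))) := by
          rw [← Finset.mul_sum]
          refine mul_le_mul_of_nonneg_left ?_ (by positivity)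
          refine (deg_one_sum_le (𝓞 K) Y
            (fun m => Real.log m * (m : ℝ) ^ s / (m : ℝ)) (fun m => ?_)).trans ?_
          · have := Real.log_natCast_nonneg m
            positivity
          · rw [hrank]
            push_cast
            refine mul_le_mul_of_nonneg_left ?_ (by positivity)
            refine (hth Y).trans (mul_le_mul_of_nonneg_left ?_ hC₂.le)
            exact hpowT _ (by positivity) le_rfl
      _ = C₄ * n := by rw [hC₄, hn]; ring
  rw [abs_le] at hG1
  have hlC : 0 ≤ Real.log C₀ := Real.log_nonneg hC₀1
  have hkey : |n * (M1 (𝓞 K) Y - (d + 1) * Real.log T)| ≤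
      n * (Real.log C₀ + C₃ * B + C₄) := by
    have : 0 ≤ n * Real.log C₀ := by positivity
    have : 0 ≤ C₃ * n * B := by positivity
    rw [abs_le]
    constructor <;> nlinarith
  rw [abs_mul, abs_of_pos hn0] at hkey
  exact le_of_mul_le_mul_left hkey hn0
end Part4

section Part5
open Filter NumberField

noncomputable def hc (R : Type*) [CommRing R] (p : ℕ) : ℕ := Nat.card (R →+* ZMod p)

section
variable {R : Type*} [CommRing R] [IsDedekindDomain R] [Module.Free ℤ R] [Module.Finite ℤ R]
  [CharZero R]

theorem ker_norm (p : ℕ) (φ : R →+* ZMod p) : Ideal.absNorm (RingHom.ker φ) = p := by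
  rw [Ideal.absNorm_apply, Submodule.cardQuot_apply]
  rw [Nat.card_congr (RingHom.quotientKerEquivOfSurjective (ZMod.ringHom_surjective φ)).toEquiv,
    Nat.card_zmod]

open Classical in
noncomputable def homEquiv (p Y : ℕ) (hp : p.Prime) (hY : p ≤ Y) :
    (R →+* ZMod p) ≃ {P // P ∈ (pset R Y).filter (fun P => Ideal.absNorm P = p)} := by
  haveI : Fact p.Prime := ⟨hp⟩
  refine Equiv.ofBijective (fun φ => ⟨RingHom.ker φ, ?_⟩) ⟨?_, ?_⟩
  · rw [Finset.mem_filter, mem_pset]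
    refine ⟨⟨RingHom.ker_isPrime φ, ?_, ?_⟩, ker_norm p φ⟩
    · intro h
      have := ker_norm p φ
      rw [h, Ideal.absNorm_bot] at this
      exact hp.ne_zero this.symm
    · rw [ker_norm]; exact hY
  · intro φ ψ h
    exact ZMod.ringHom_eq_of_ker_eq φ ψ (congrArg Subtype.val h)
  · rintro ⟨P, hP⟩
    rw [Finset.mem_filter, mem_pset] at hP
    have hc : Nat.card (R ⧸ P) = p := by
      have := hP.2
      rwa [Ideal.absNorm_apply, Submodule.cardQuot_apply] at this
    haveI : Finite (R ⧸ P) := Nat.finite_of_card_ne_zero (by rw [hc]; exact hp.ne_zero)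
    letI : Fintype (R ⧸ P) := Fintype.ofFinite _
    rw [Nat.card_eq_fintype_card] at hc
    let e := (ZMod.ringEquivOfPrime (R ⧸ P) hp hc).symm
    refine ⟨e.toRingHom.comp (Ideal.Quotient.mk P), ?_⟩
    apply Subtype.ext
    ext x
    simp [RingHom.mem_ker, Ideal.Quotient.eq_zero_iff_mem]

open Classical in
theorem hom_card (p Y : ℕ) (hp : p.Prime) (hY : p ≤ Y) :
    ((pset R Y).filter (fun P => Ideal.absNorm P = p)).card = hc R p := by
  rw [hc, Nat.card_congr (homEquiv p Y hp hY), Nat.card_eq_fintype_card, Fintype.card_coe]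

theorem hom_finite (p : ℕ) (hp : p.Prime) : Finite (R →+* ZMod p) :=
  Finite.of_equiv _ (homEquiv (R := R) p p hp le_rfl).symm

theorem hc_le (p : ℕ) (hp : p.Prime) : hc R p ≤ Module.finrank ℤ R := by
  classical
  rw [← hom_card p p hp le_rfl]
  refine card_above p hp _ ?_
  intro P hP
  rw [Finset.mem_filter, mem_pset] at hP
  refine ⟨hP.1.1, hP.1.2.1, ?_⟩
  have := Ideal.absNorm_mem P
  rwa [hP.2] at this

theorem M1_eq (N : ℕ) :
    M1 R N = ∑ p ∈ Nat.primesLE N, (hc R p : ℝ) * (Real.log p / p) := by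
  classical
  unfold M1
  rw [← Finset.sum_fiberwise_of_maps_to (s := (pset R N).filter _) (t := Nat.primesLE N)
    (g := fun P => Ideal.absNorm P)]
  · refine Finset.sum_congr rfl fun p hp => ?_
    rw [Nat.mem_primesLE] at hp
    rw [← hom_card p N hp.2 hp.1, ← nsmul_eq_mul, ← Finset.sum_const]
    have : ((pset R N).filter (fun P => (Ideal.absNorm P).Prime)).filter
        (fun P => Ideal.absNorm P = p) = (pset R N).filter (fun P => Ideal.absNorm P = p) := by
      ext P
      simp only [Finset.mem_filter]
      constructor
      · rintro ⟨⟨a, b⟩, c⟩; exact ⟨a, c⟩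
      · rintro ⟨a, c⟩; exact ⟨⟨a, c ▸ hp.2⟩, c⟩
    rw [this]
    refine Finset.sum_congr rfl fun P hP => ?_
    rw [(Finset.mem_filter.mp hP).2]
  · intro P hP
    rw [Finset.mem_filter, mem_pset] at hP
    rw [Nat.mem_primesLE]
    exact ⟨hP.1.2.2, hP.2⟩

theorem M1_mono {a b : ℕ} (h : a ≤ b) : M1 R a ≤ M1 R b := by
  rw [M1_eq, M1_eq]
  refine Finset.sum_le_sum_of_subset_of_nonneg ?_ ?_
  · intro p hp
    rw [Nat.mem_primesLE] at hp ⊢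
    exact ⟨hp.1.trans h, hp.2⟩
  · intro p hp _
    rw [Nat.mem_primesLE] at hp
    have := Real.log_natCast_nonneg p
    positivity

end

theorem main2 (K : Type*) [Field K] [NumberField K] :
    ∃ C : ℝ, ∀ N : ℕ, 0 < N → |M1 (𝓞 K) N - Real.log N| ≤ C := by
  obtain ⟨d, hd⟩ : ∃ d, Module.finrank ℚ K = d + 1 :=
    ⟨Module.finrank ℚ K - 1, by have : 0 < Module.finrank ℚ K := Module.finrank_pos
                                omega⟩
  obtain ⟨C₀, hC₀, C, hC⟩ := main1 K d hd
  have hM0 : ∀ n, 0 ≤ M1 (𝓞 K) n := by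
    intro n
    rw [M1_eq]
    refine Finset.sum_nonneg fun p _ => ?_
    have := Real.log_natCast_nonneg p
    positivity
  have hlogC : 0 ≤ Real.log C₀ := Real.log_natCast_nonneg _
  refine ⟨M1 (𝓞 K) C₀ + Real.log C₀ + |C| + (d + 1) * Real.log 2, ?_⟩
  intro N hN
  have hl2 : 0 ≤ ((d : ℝ) + 1) * Real.log 2 := by positivity
  by_cases hlt : N < C₀
  · have h1 := M1_mono (R := 𝓞 K) hlt.le
    have h2 : Real.log N ≤ Real.log C₀ :=
      Real.log_le_log (by exact_mod_cast hN) (by exact_mod_cast hlt.le)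
    have h3 := Real.log_natCast_nonneg N
    have h4 := hM0 N
    have h5 := abs_nonneg C
    have h6 := hM0 C₀
    rw [abs_le]; constructor <;> linarith
  · push Not at hlt
    have hex : ∃ T : ℕ, 0 < T ∧ C₀ * T ^ (d + 1) ≤ N ∧ N < C₀ * (T + 1) ^ (d + 1) := by
      have hP : ∃ n : ℕ, N < C₀ * (n + 1) ^ (d + 1) := by
        refine ⟨N, ?_⟩
        calc N < N + 1 := by omega
          _ ≤ (N + 1) ^ (d + 1) := Nat.le_self_pow (by omega) _
          _ ≤ C₀ * (N + 1) ^ (d + 1) := Nat.le_mul_of_pos_left _ hC₀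
      classical
      refine ⟨Nat.find hP, ?_, ?_, Nat.find_spec hP⟩
      · rw [Nat.pos_iff_ne_zero]
        intro h0
        have := Nat.find_spec hP
        rw [h0] at this
        simp at this
        omega
      · by_contra hcon
        push Not at hcon
        have hpos : 0 < Nat.find hP := by
          rw [Nat.pos_iff_ne_zero]
          intro h0
          have := Nat.find_spec hP
          rw [h0] at this
          simp at this
          omega
        have := Nat.find_min hP (m := Nat.find hP - 1) (by omega)
        apply this
        rwa [Nat.sub_add_cancel hpos]
    obtain ⟨T, hT, hTl, hTu⟩ := hex
    have e1 := abs_le.mp (hC T hT)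
    have e2 := abs_le.mp (hC (T + 1) (by omega))
    have m1 := M1_mono (R := 𝓞 K) hTl
    have m2 := M1_mono (R := 𝓞 K) hTu.le
    have hTr : (0 : ℝ) < T := by exact_mod_cast hT
    have hCr : (0 : ℝ) < C₀ := by exact_mod_cast hC₀
    have l1 : Real.log C₀ + (d + 1) * Real.log T ≤ Real.log N := by
      have : ((C₀ : ℝ) * T ^ (d + 1)) ≤ N := by exact_mod_cast hTl
      have := Real.log_le_log (by positivity) this
      rw [Real.log_mul (by positivity) (by positivity), Real.log_pow] at this
      push_cast at this; exact this
    have l2 : Real.log N ≤ Real.log C₀ + (d + 1) * Real.log ((T + 1 : ℕ) : ℝ) := by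
      have : (N : ℝ) ≤ ((C₀ : ℝ) * ((T + 1 : ℕ) : ℝ) ^ (d + 1)) := by exact_mod_cast hTu.le
      have := Real.log_le_log (by exact_mod_cast hN) this
      rw [Real.log_mul (by positivity) (by positivity), Real.log_pow] at this
      push_cast at this ⊢; exact this
    have l3 : Real.log ((T + 1 : ℕ) : ℝ) ≤ Real.log 2 + Real.log T := by
      rw [← Real.log_mul (by norm_num) (by positivity)]
      apply Real.log_le_log (by positivity)
      have : T + 1 ≤ 2 * T := by omega
      exact_mod_cast this
    have l4 : ((d : ℝ) + 1) * Real.log ((T + 1 : ℕ) : ℝ) ≤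
        (d + 1) * Real.log 2 + (d + 1) * Real.log T := by
      rw [← mul_add]; exact mul_le_mul_of_nonneg_left l3 (by positivity)
    have h5 := le_abs_self C
    have h6 := hM0 C₀
    rw [abs_le]
    constructor <;> linarith [e1.1, e1.2, e2.1, e2.2]
end Part5

section Part6
open Filter NumberField
set_option linter.unusedSectionVars false
set_option linter.style.haveILetI false

theorem exists_K (A B : ℤ) : ∃ (K : Type) (_ : Field K) (_ : NumberField K),
    Odd (Module.finrank ℚ K) ∧ ∃ α : 𝓞 K, α ^ 3 + (A : 𝓞 K) * α + (B : 𝓞 K) = 0 := by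
  have key : ∀ (K : Type) [Field K] [NumberField K] (a : K),
      a ^ 3 + (A : K) * a + (B : K) = 0 →
      ∃ α : 𝓞 K, α ^ 3 + (A : 𝓞 K) * α + (B : 𝓞 K) = 0 := by
    intro K _ _ a ha
    have hint : IsIntegral ℤ a := by
      refine ⟨Polynomial.X ^ 3 + (Polynomial.C A * Polynomial.X + Polynomial.C B), ?_, ?_⟩
      · monicity!
      · simp only [Polynomial.eval₂_add, Polynomial.eval₂_mul, Polynomial.eval₂_pow,
          Polynomial.eval₂_X, Polynomial.eval₂_C, ← add_assoc]
        exact ha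
    refine ⟨⟨a, hint⟩, ?_⟩
    apply RingOfIntegers.ext
    simp only [map_add, map_mul, map_pow, map_intCast, map_zero]
    exact ha
  let f : Polynomial ℚ := Polynomial.X ^ 3 +
    (Polynomial.C (A : ℚ) * Polynomial.X + Polynomial.C (B : ℚ))
  have hdeg : f.natDegree = 3 := by unfold f; compute_degree!
  have hmon : f.Monic := by unfold f; monicity!
  by_cases hirr : Irreducible f
  · haveI : Fact (Irreducible f) := ⟨hirr⟩
    haveI : FiniteDimensional ℚ (AdjoinRoot f) :=
      (AdjoinRoot.powerBasis hirr.ne_zero).finite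
    haveI : CharZero (AdjoinRoot f) := algebraRat.charZero _
    haveI : NumberField (AdjoinRoot f) := { }
    refine ⟨AdjoinRoot f, inferInstance, inferInstance, ?_, ?_⟩
    · have h3 : Module.finrank ℚ (AdjoinRoot f) = 3 := by
        rw [(AdjoinRoot.powerBasis hirr.ne_zero).finrank, AdjoinRoot.powerBasis_dim, hdeg]
      have : ∀ (inst : Module ℚ (AdjoinRoot f)), @Module.finrank ℚ (AdjoinRoot f) _ _ inst = 3 := by
        intro inst
        rw [← h3]
        congr 1
        exact Subsingleton.elim _ _
      rw [this]; decide
    · apply key _ (AdjoinRoot.root f)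
      have h0 := AdjoinRoot.eval₂_root f
      have this : ∀ (g : ℚ →+* AdjoinRoot f) (a : AdjoinRoot f), f.eval₂ g a =
          a ^ 3 + (A : AdjoinRoot f) * a + (B : AdjoinRoot f) := by
        intro g a
        have hA : g (A : ℚ) = (A : AdjoinRoot f) := map_intCast g A
        have hB : g (B : ℚ) = (B : AdjoinRoot f) := map_intCast g B
        rw [← hA, ← hB, add_assoc]
        simp only [f, Polynomial.eval₂_add, Polynomial.eval₂_mul, Polynomial.eval₂_pow,
          Polynomial.eval₂_X, Polynomial.eval₂_C]
      rw [this] at h0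
      exact h0
  · rw [hmon.irreducible_iff_roots_eq_zero_of_degree_le_three (by omega) (by omega)] at hirr
    obtain ⟨r, hr⟩ := Multiset.exists_mem_of_ne_zero hirr
    rw [Polynomial.mem_roots hmon.ne_zero, Polynomial.IsRoot.def] at hr
    refine ⟨ℚ, inferInstance, inferInstance, by simp, key ℚ r ?_⟩
    simp only [f, Polynomial.eval_add, Polynomial.eval_mul, Polynomial.eval_pow,
        Polynomial.eval_X, Polynomial.eval_C, ← add_assoc] at hr
    exact hr

theorem two_not_sq (K : Type) [Field K] [NumberField K] (hodd : Odd (Module.finrank ℚ K))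
    (r : K) : r ^ 2 ≠ 2 := by
  intro h
  have h1 : Algebra.norm ℚ r ^ 2 = 2 ^ Module.finrank ℚ K := by
    rw [← map_pow, h]
    have := Algebra.norm_algebraMap (R := ℚ) (S := K) 2
    simpa using this
  obtain ⟨k, hk⟩ := hodd
  rw [hk] at h1
  have h2 : IsSquare (2 : ℚ) := by
    refine ⟨Algebra.norm ℚ r / 2 ^ k, ?_⟩
    field_simp
    rw [h1]; ring
  have h3 : ¬ IsSquare (2 : ℚ) := by
    have : ¬ IsSquare ((2 : ℕ) : ℚ) := by
      rw [Rat.isSquare_natCast_iff]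
      exact Nat.prime_two.prime.irreducible.not_isSquare
    exact_mod_cast this
  exact h3 h2

section quad
variable (K : Type) [Field K] [NumberField K] [Fact (∀ r : K, r ^ 2 ≠ 2 + 0 * r)]

abbrev QL := QuadraticAlgebra K 2 0

instance QL_nf : NumberField (QL K) where
  to_finiteDimensional := Module.Finite.trans K (QL K)

variable {K}
theorem int_re (z : QL K) (hz : IsIntegral ℤ z) : IsIntegral ℤ (2 * z.re) := by
  have h1 : IsIntegral ℤ (star z) := by
    have := hz.map ((starRingEnd (QL K)).toIntAlgHom)
    exact this
  have h2 := hz.add h1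
  have h3 : algebraMap K (QL K) (2 * z.re) = z + star z := by
    ext <;> simp
    ring
  rw [← h3] at h2
  exact (isIntegral_algebraMap_iff (algebraMap K (QL K)).injective).mp h2

theorem int_omega : IsIntegral ℤ (⟨0, 1⟩ : QL K) := by
  refine ⟨Polynomial.X ^ 2 - Polynomial.C 2, by monicity!, ?_⟩
  have h : (⟨0, 1⟩ : QL K) ^ 2 = algebraMap K (QL K) 2 := by
    rw [pow_two]
    ext <;> simp
  rw [map_ofNat] at h
  simp only [Polynomial.eval₂_sub, Polynomial.eval₂_pow, Polynomial.eval₂_X, Polynomial.eval₂_C]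
  rw [h, map_ofNat, sub_self]

theorem int_im (z : QL K) (hz : IsIntegral ℤ z) : IsIntegral ℤ (4 * z.im) := by
  have := int_re _ (hz.mul (int_omega (K := K)))
  simp at this
  convert this using 1
  have h22 : (4 : K) = 2 * 2 := by norm_num
  rw [h22, mul_assoc]

theorem int_re4 (z : QL K) (hz : IsIntegral ℤ z) : IsIntegral ℤ (4 * z.re) := by
  have h := int_re z hz
  have e : ∀ x : K, 4 * x = 2 * x + 2 * x := fun x => by ring
  rw [e]
  exact h.add h

def toO (z : QL K) (h : IsIntegral ℤ z) : 𝓞 (QL K) := ⟨z, h⟩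
theorem coe_toO (z : QL K) (h : IsIntegral ℤ z) : ((toO z h : 𝓞 (QL K)) : QL K) = z := rfl

noncomputable def re4 (β : 𝓞 (QL K)) : 𝓞 K := ⟨4 * (β : QL K).re, int_re4 _ β.2⟩
noncomputable def im4 (β : 𝓞 (QL K)) : 𝓞 K := ⟨4 * (β : QL K).im, int_im _ β.2⟩

theorem coe_re4 (β : 𝓞 (QL K)) : ((re4 β : 𝓞 K) : K) = 4 * (β : QL K).re := rfl
theorem coe_im4 (β : 𝓞 (QL K)) : ((im4 β : 𝓞 K) : K) = 4 * (β : QL K).im := rfl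

theorem re4_mul (β γ : 𝓞 (QL K)) : 4 * re4 (β * γ) = re4 β * re4 γ + 2 * (im4 β * im4 γ) := by
  apply RingOfIntegers.ext
  simp only [map_mul, map_add, coe_re4, coe_im4, map_ofNat]
  simp
  ring
theorem im4_mul (β γ : 𝓞 (QL K)) : 4 * im4 (β * γ) = re4 β * im4 γ + im4 β * re4 γ := by
  apply RingOfIntegers.ext
  simp only [map_mul, map_add, coe_re4, coe_im4, map_ofNat]
  simp
  ring
theorem re4_add (β γ : 𝓞 (QL K)) : re4 (β + γ) = re4 β + re4 γ := by
  apply RingOfIntegers.ext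
  simp only [map_add, coe_re4]
  simp
  ring
theorem im4_add (β γ : 𝓞 (QL K)) : im4 (β + γ) = im4 β + im4 γ := by
  apply RingOfIntegers.ext
  simp only [map_add, coe_im4]
  simp
  ring
theorem re4_one : re4 (1 : 𝓞 (QL K)) = 4 := by
  apply RingOfIntegers.ext
  simp only [coe_re4, map_one, map_ofNat]
  have : (1 : QL K).re = 1 := rfl
  rw [this, mul_one]
theorem im4_one : im4 (1 : 𝓞 (QL K)) = 0 := by
  apply RingOfIntegers.ext
  simp only [coe_im4, map_one, map_zero]
  have : (1 : QL K).im = 0 := rfl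
  rw [this, mul_zero]

noncomputable def extHom (p : ℕ) [Fact p.Prime] (h4 : (4 : ZMod p) ≠ 0) (φ : 𝓞 K →+* ZMod p)
    (s : ZMod p) (hs : s ^ 2 = 2) : 𝓞 (QL K) →+* ZMod p :=
  RingHom.mk'
    { toFun := fun β => (φ (re4 β) + φ (im4 β) * s) / 4
      map_one' := by
        rw [re4_one, im4_one, map_ofNat, map_zero, zero_mul, add_zero, div_self h4]
      map_mul' := by
        intro β γ
        have e1 := congrArg φ (re4_mul β γ)
        have e2 := congrArg φ (im4_mul β γ)
        simp only [map_mul, map_add, map_ofNat] at e1 e2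
        field_simp
        linear_combination e1 + s * e2 - φ (im4 β) * φ (im4 γ) * hs }
    (by
      intro β γ
      change (φ (re4 (β + γ)) + φ (im4 (β + γ)) * s) / 4 = (φ (re4 β) + φ (im4 β) * s) / 4 +
        (φ (re4 γ) + φ (im4 γ) * s) / 4
      rw [re4_add, im4_add, map_add, map_add]; ring)

theorem extHom_apply (p : ℕ) [Fact p.Prime] (h4 : (4 : ZMod p) ≠ 0) (φ : 𝓞 K →+* ZMod p)
    (s : ZMod p) (hs : s ^ 2 = 2) (β : 𝓞 (QL K)) :
    extHom p h4 φ s hs β = (φ (re4 β) + φ (im4 β) * s) / 4 := rfl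

theorem extHom_alg (p : ℕ) [Fact p.Prime] (h4 : (4 : ZMod p) ≠ 0) (φ : 𝓞 K →+* ZMod p)
    (s : ZMod p) (hs : s ^ 2 = 2) (x : 𝓞 K) :
    extHom p h4 φ s hs (toO (algebraMap K (QL K) x) (RingOfIntegers.isIntegral_coe x).algebraMap)
      = φ x := by
  rw [extHom_apply]
  have e1 : re4 ((toO (algebraMap K (QL K) x) (RingOfIntegers.isIntegral_coe x).algebraMap) :
      𝓞 (QL K)) = 4 * x := by
    apply RingOfIntegers.ext
    rw [coe_re4, coe_toO]; simp only [map_mul, map_ofNat]; simp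
  have e2 : im4 ((toO (algebraMap K (QL K) x) (RingOfIntegers.isIntegral_coe x).algebraMap) :
      𝓞 (QL K)) = 0 := by
    apply RingOfIntegers.ext
    rw [coe_im4, coe_toO]; simp
  rw [e1, e2, map_zero, map_mul, map_ofNat, zero_mul, add_zero, mul_div_cancel_left₀ _ h4]

theorem extHom_om (p : ℕ) [Fact p.Prime] (h4 : (4 : ZMod p) ≠ 0) (φ : 𝓞 K →+* ZMod p)
    (s : ZMod p) (hs : s ^ 2 = 2) :
    extHom p h4 φ s hs (toO ⟨0, 1⟩ int_omega) = s := by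
  rw [extHom_apply]
  have e1 : re4 ((toO ⟨0, 1⟩ int_omega) : 𝓞 (QL K)) = 0 := by
    apply RingOfIntegers.ext
    rw [coe_re4, coe_toO]; simp
  have e2 : im4 ((toO ⟨0, 1⟩ int_omega) : 𝓞 (QL K)) = 4 := by
    apply RingOfIntegers.ext
    rw [coe_im4, coe_toO]; simp only [map_ofNat]; simp
  rw [e1, e2, map_zero, map_ofNat, zero_add, mul_div_cancel_left₀ _ h4]

theorem hc_two (p : ℕ) (hp : p.Prime) (hp2 : p ≠ 2) (hsq : IsSquare (2 : ZMod p)) :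
    2 * hc (𝓞 K) p ≤ hc (𝓞 (QL K)) p := by
  haveI : Fact p.Prime := ⟨hp⟩
  have h2 : (2 : ZMod p) ≠ 0 := by
    intro h
    have : ((2 : ℕ) : ZMod p) = 0 := by exact_mod_cast h
    rw [ZMod.natCast_eq_zero_iff] at this
    exact hp2 ((Nat.prime_dvd_prime_iff_eq hp Nat.prime_two).mp this)
  have h4 : (4 : ZMod p) ≠ 0 := by
    have : (4 : ZMod p) = 2 * 2 := by norm_num
    rw [this]; exact mul_ne_zero h2 h2
  obtain ⟨s, hs⟩ := hsq
  have hs2 : s ^ 2 = 2 := by rw [hs]; ring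
  have hs0 : s ≠ 0 := by rintro rfl; apply h2; rw [hs]; ring
  have hss : ∀ b : Bool, (if b then s else -s) ^ 2 = 2 := by
    intro b; cases b <;> simp [hs2]
  let F : Bool × (𝓞 K →+* ZMod p) → (𝓞 (QL K) →+* ZMod p) := fun x =>
    extHom p h4 x.2 (if x.1 then s else -s) (hss x.1)
  have hF : Function.Injective F := by
    rintro ⟨b, φ⟩ ⟨c, ψ⟩ h
    have e1 := congrArg (fun f : 𝓞 (QL K) →+* ZMod p => f (toO ⟨0, 1⟩ int_omega)) h
    simp only [F, extHom_om] at e1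
    have e2 : φ = ψ := by
      ext x
      have := congrArg (fun f : 𝓞 (QL K) →+* ZMod p =>
        f (toO (algebraMap K (QL K) x) (RingOfIntegers.isIntegral_coe x).algebraMap)) h
      simpa only [F, extHom_alg] using this
    have hne : s ≠ -s := by
      intro h
      have : 2 * s = 0 := by linear_combination h
      exact (mul_ne_zero h2 hs0) this
    have e3 : b = c := by
      cases b <;> cases c <;> simp at e1 ⊢
      · exact hne e1.symm
      · exact hne e1
    rw [e2, e3]
  haveI := hom_finite (R := 𝓞 (QL K)) p hp
  have := Nat.card_le_card_of_injective F hF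
  rw [Nat.card_prod] at this
  simpa [hc] using this
end quad

theorem exists_L (K : Type) [Field K] [NumberField K] (hodd : Odd (Module.finrank ℚ K)) :
    ∃ (L : Type) (_ : Field L) (_ : NumberField L), ∀ p : ℕ, p.Prime → p ≠ 2 →
      IsSquare (2 : ZMod p) → 2 * hc (𝓞 K) p ≤ hc (𝓞 L) p := by
  haveI : Fact (∀ r : K, r ^ 2 ≠ 2 + 0 * r) := ⟨fun r => by
    rw [zero_mul, add_zero]; exact two_not_sq K hodd r⟩
  exact ⟨QL K, inferInstance, inferInstance, fun p hp h2 hs => hc_two p hp h2 hs⟩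
end Part6

open NumberField in
theorem count_lower (A B : ℤ) : ∃ k : ℝ, 0 < k ∧ ∃ N₀ : ℕ, ∀ N : ℕ, N₀ ≤ N →
    ∃ G : Finset ℕ, (∀ p ∈ G, p.Prime ∧ p ≤ N ∧ (p % 8 = 3 ∨ p % 8 = 5) ∧
      ∃ x : ZMod p, x ^ 3 + (A : ZMod p) * x + (B : ZMod p) = 0) ∧
      (N : ℝ) ≤ k * G.card * Real.log N := by
  classical
  obtain ⟨K, _, _, hodd, α, hα⟩ := exists_K A B
  obtain ⟨L, _, _, hL⟩ := exists_L K hodd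
  obtain ⟨CK, hCK⟩ := main2 K
  obtain ⟨CL, hCL⟩ := main2 L
  obtain ⟨c, hc1⟩ := exists_nat_ge (Real.exp (2 * (1 + 2 * CK + CL)))
  have hcr : (0 : ℝ) < c := lt_of_lt_of_le (Real.exp_pos _) hc1
  have hc0 : 0 < c := by exact_mod_cast hcr
  have hlogc : 2 * (1 + 2 * CK + CL) ≤ Real.log c := by
    rwa [Real.le_log_iff_exp_le hcr]
  set n := Module.finrank ℤ (𝓞 K) with hn
  have hnpos : 0 < n := Module.finrank_pos
  refine ⟨n * c, by positivity, 3 * c, ?_⟩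
  intro N hN
  have hN0 : 0 < N := by omega
  have hNr : (0 : ℝ) < N := by exact_mod_cast hN0
  set m := N / c with hm
  have hm3 : 3 ≤ m := by
    rw [hm, Nat.le_div_iff_mul_le hc0]; exact hN
  have hmN : m ≤ N := Nat.div_le_self _ _
  have hmc : m * c ≤ N := Nat.div_mul_le_self _ _
  have hmc2 : N < (m + 1) * c := by
    rw [hm]; exact (Nat.div_lt_iff_lt_mul hc0).mp (Nat.lt_succ_self _)
  have hmr : (0 : ℝ) < m := by exact_mod_cast (by omega : 0 < m)
  have hlog : Real.log m + Real.log c ≤ Real.log N := by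
    rw [← Real.log_mul hmr.ne' hcr.ne']
    exact Real.log_le_log (by positivity) (by exact_mod_cast hmc)
  set D := Nat.primesLE N \ Nat.primesLE m with hD
  have hDmem : ∀ p, p ∈ D → p.Prime ∧ p ≤ N ∧ m < p := by
    intro p hp
    rw [hD, Finset.mem_sdiff, Nat.mem_primesLE, Nat.mem_primesLE] at hp
    refine ⟨hp.1.2, hp.1.1, ?_⟩
    by_contra hcon
    exact hp.2 ⟨by omega, hp.1.2⟩
  have hsub : Nat.primesLE m ⊆ Nat.primesLE N := by
    intro p hp
    rw [Nat.mem_primesLE] at hp ⊢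
    exact ⟨hp.1.trans hmN, hp.2⟩
  have dK : M1 (𝓞 K) N - M1 (𝓞 K) m = ∑ p ∈ D, (hc (𝓞 K) p : ℝ) * (Real.log p / p) := by
    rw [M1_eq, M1_eq, ← Finset.sum_sdiff hsub]; ring
  have dL : M1 (𝓞 L) N - M1 (𝓞 L) m = ∑ p ∈ D, (hc (𝓞 L) p : ℝ) * (Real.log p / p) := by
    rw [M1_eq, M1_eq, ← Finset.sum_sdiff hsub]; ring
  have k1 := abs_le.mp (hCK N hN0)
  have k2 := abs_le.mp (hCK m (by omega))
  have k3 := abs_le.mp (hCL N hN0)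
  have k4 := abs_le.mp (hCL m (by omega))
  have hlow : 1 ≤ ∑ p ∈ D, ((hc (𝓞 K) p : ℝ) * (Real.log p / p) -
      (1 / 2) * ((hc (𝓞 L) p : ℝ) * (Real.log p / p))) := by
    rw [Finset.sum_sub_distrib, ← Finset.mul_sum, ← dK, ← dL]
    linarith [k1.1, k1.2, k2.1, k2.2, k3.1, k3.2, k4.1, k4.2]
  set G := D.filter (fun p => (p % 8 = 3 ∨ p % 8 = 5) ∧ 0 < hc (𝓞 K) p) with hG
  refine ⟨G, ?_, ?_⟩
  · intro p hp
    rw [hG, Finset.mem_filter] at hp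
    obtain ⟨h1, h2, h3⟩ := hDmem p hp.1
    refine ⟨h1, h2, hp.2.1, ?_⟩
    have h4 := hp.2.2
    unfold hc at h4
    obtain ⟨⟨φ⟩, _⟩ := Nat.card_pos_iff.mp h4
    refine ⟨φ α, ?_⟩
    have := congrArg φ hα
    simpa only [map_add, map_mul, map_pow, map_intCast, map_zero] using this
  · have hNlog : 0 ≤ Real.log N := Real.log_natCast_nonneg N
    have hpt : ∀ p ∈ D, (hc (𝓞 K) p : ℝ) * (Real.log p / p) -
      (1 / 2) * ((hc (𝓞 L) p : ℝ) * (Real.log p / p)) ≤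
        if (p % 8 = 3 ∨ p % 8 = 5) ∧ 0 < hc (𝓞 K) p then n * c * Real.log N / N else 0 := by
      intro p hp
      obtain ⟨h1, h2, h3⟩ := hDmem p hp
      have hw : 0 ≤ Real.log p / p := by
        have := Real.log_natCast_nonneg p
        positivity
      have hLw : 0 ≤ (hc (𝓞 L) p : ℝ) * (Real.log p / p) := by positivity
      split_ifs with hcond
      · have hpr : (0 : ℝ) < p := by exact_mod_cast h1.pos
        have e1 : (hc (𝓞 K) p : ℝ) ≤ n := by exact_mod_cast hc_le p h1
        have e2 : Real.log p ≤ Real.log N := Real.log_le_log hpr (by exact_mod_cast h2)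
        have e3 : (N : ℝ) ≤ p * c := by
          have : (m + 1) * c ≤ p * c := Nat.mul_le_mul_right _ h3
          exact_mod_cast (hmc2.le.trans this)
        have e4 : Real.log p / p ≤ c * Real.log N / N := by
          rw [div_le_div_iff₀ hpr hNr]
          calc Real.log p * N ≤ Real.log N * (p * c) := by gcongr
            _ = c * Real.log N * p := by ring
        calc _ ≤ (hc (𝓞 K) p : ℝ) * (Real.log p / p) := by linarith
          _ ≤ n * (c * Real.log N / N) := by gcongr
          _ = _ := by ring
      · by_cases h0 : hc (𝓞 K) p = 0
        · rw [h0]; push_cast; linarith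
        · have hp2 : p ≠ 2 := by omega
          haveI : Fact p.Prime := ⟨h1⟩
          have hsq : IsSquare (2 : ZMod p) := by
            rw [ZMod.exists_sq_eq_two_iff hp2]
            have := (Nat.Prime.mod_two_eq_one_iff_ne_two h1).mpr hp2
            have h5 : ¬ (p % 8 = 3 ∨ p % 8 = 5) := fun h => hcond ⟨h, by omega⟩
            omega
          have := hL p h1 hp2 hsq
          have : (2 : ℝ) * hc (𝓞 K) p ≤ hc (𝓞 L) p := by exact_mod_cast this
          have := mul_le_mul_of_nonneg_right this hw
          linarith
    have hsum := hlow.trans (Finset.sum_le_sum hpt)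
    rw [← Finset.sum_filter, Finset.sum_const, nsmul_eq_mul] at hsum
    rw [← hG, ← mul_div_assoc, le_div_iff₀ hNr] at hsum
    linarith

theorem primePi_eq {X : ℝ} (hX : 0 ≤ X) : primePi X = Nat.primeCounting ⌊X⌋₊ := by
  rw [primePi, ← Nat.primesLE_card_eq_primeCounting, ← Set.ncard_coe_finset, ← Nat.card_coe_set_eq]
  congr 2
  ext p
  simp only [Set.mem_ofPred_eq, Finset.mem_coe, Nat.mem_primesLE]
  rw [Nat.le_floor_iff hX, and_comm]

theorem le_primeCount {S : Set ℕ} {X : ℝ} (hX : 0 ≤ X) (G : Finset ℕ)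
    (hG : ∀ p ∈ G, p.Prime ∧ p ≤ ⌊X⌋₊ ∧ p ∈ S) : G.card ≤ primeCount S X := by
  rw [primeCount, Nat.card_coe_set_eq, ← Set.ncard_coe_finset]
  apply Set.ncard_le_ncard
  · intro p hp
    obtain ⟨h1, h2, h3⟩ := hG p hp
    exact ⟨h1, h3, (Nat.le_floor_iff hX).mp h2⟩
  · refine (Set.finite_Iic ⌊X⌋₊).subset ?_
    rintro p ⟨_, _, h⟩
    exact (Nat.le_floor_iff hX).mpr h

theorem primeCount_le {S : Set ℕ} {X : ℝ} (hX : 0 ≤ X) : primeCount S X ≤ primePi X := by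
  rw [primeCount, primePi, Nat.card_coe_set_eq, Nat.card_coe_set_eq]
  apply Set.ncard_le_ncard
  · rintro p ⟨h1, _, h3⟩
    exact ⟨h1, h3⟩
  · refine (Set.finite_Iic ⌊X⌋₊).subset ?_
    rintro p ⟨_, h⟩
    exact (Nat.le_floor_iff hX).mpr h

/-- For `A, B ∈ ℤ` with `4A³ + 27B² ≠ 0`, the set of primes `ℓ ≡ 3, 5 (mod 8)` modulo
which `x³ + Ax + B` has a root has lower natural density at least some `δ > 0`. -/
theorem pos_lower_density_aux_primes (A B : ℤ) (hΔ : 4 * A ^ 3 + 27 * B ^ 2 ≠ 0) :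
    ∃ δ : ℝ, 0 < δ ∧
      δ ≤ Filter.liminf
        (fun X : ℝ =>
          (primeCount {ℓ : ℕ | (ℓ % 8 = 3 ∨ ℓ % 8 = 5) ∧
            ∃ x : ZMod ℓ, x ^ 3 + (A : ZMod ℓ) * x + (B : ZMod ℓ) = 0} X : ℝ) /
            (primePi X : ℝ))
        atTop := by
  obtain ⟨k, hk, N₀, hcnt⟩ := count_lower A B
  have hl4 : 0 < Real.log 4 := Real.log_pos (by norm_num)
  refine ⟨1 / (k * (Real.log 4 + 1)), by positivity, ?_⟩
  apply le_liminf_of_le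
  · apply IsBoundedUnder.isCoboundedUnder_ge
    refine isBoundedUnder_of_eventually_le (a := 1) ?_
    filter_upwards [eventually_ge_atTop 0] with X hX
    apply div_le_one_of_le₀ _ (by positivity)
    exact_mod_cast primeCount_le hX
  · have hfl : Tendsto (fun X : ℝ => ((⌊X⌋₊ : ℕ) : ℝ)) atTop atTop :=
      tendsto_natCast_atTop_atTop.comp tendsto_nat_floor_atTop
    filter_upwards [eventually_ge_atTop 0,
      hfl.eventually (Chebyshev.eventually_primeCounting_le one_pos),
      hfl.eventually (eventually_ge_atTop 2),
      tendsto_nat_floor_atTop.eventually (eventually_ge_atTop N₀)] with X hX hpi h2 hN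
    rw [Nat.floor_natCast, ← primePi_eq hX] at hpi
    obtain ⟨G, hG, hcard⟩ := hcnt _ hN
    have hle := le_primeCount (S := {ℓ : ℕ | (ℓ % 8 = 3 ∨ ℓ % 8 = 5) ∧
            ∃ x : ZMod ℓ, x ^ 3 + (A : ZMod ℓ) * x + (B : ZMod ℓ) = 0}) hX G
      (fun p hp => ⟨(hG p hp).1, (hG p hp).2.1, (hG p hp).2.2⟩)
    generalize primeCount _ X = q at hle ⊢
    have h2n : 2 ≤ ⌊X⌋₊ := by exact_mod_cast h2
    set N : ℝ := ((⌊X⌋₊ : ℕ) : ℝ)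
    have hlog : 0 < Real.log N := Real.log_pos (by linarith)
    have hpipos : 0 < primePi X := by
      rw [primePi_eq hX, ← Nat.primesLE_card_eq_primeCounting, Finset.card_pos]
      refine ⟨2, ?_⟩
      rw [Nat.mem_primesLE]
      exact ⟨h2n, Nat.prime_two⟩
    have hpipos' : (0 : ℝ) < primePi X := by exact_mod_cast hpipos
    rw [div_le_div_iff₀ (by positivity) hpipos', one_mul]
    have hle' : (G.card : ℝ) ≤ q := by exact_mod_cast hle
    rw [le_div_iff₀ hlog] at hpi
    have : (primePi X : ℝ) * Real.log N ≤ (q * (k * (Real.log 4 + 1))) * Real.log N := by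
      calc (primePi X : ℝ) * Real.log N ≤ (Real.log 4 + 1) * N := hpi
        _ ≤ (Real.log 4 + 1) * (k * G.card * Real.log N) := by gcongr
        _ ≤ (Real.log 4 + 1) * (k * q * Real.log N) := by gcongr
        _ = _ := by ring
    exact le_of_mul_le_mul_right this hlog
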